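/- arXiv:2012.12572 — 5 statements merged into one kernel-verified Lean document; each statement's English description precedes it below -/
import Mathlib

section
/- Let d ≥ 1 and λ ≥ 1. Suppose Φ ∈ C^{d+1} is real-valued on a neighborhood of B(0,1) ⊂ ℝ^d, ψ ∈ C^{d+1} is supported in B(0,1), the map x ↦ ∇Φ(x) is injective on B(0,1), and L*(Φ) > 0. Then λ^{d/2} · |∫_{ℝ^d} e^{iλΦ(x)} ψ(x) dx| ≤ C_d · (1/L*(Φ)) · (1 + 𝒫_{d+1}^{2d+1}) · 𝒜_{d+1}, with C_d depending only on d. -/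
open MeasureTheory Metric Set

noncomputable section

/-- Euclidean space `ℝ^d`. -/
abbrev Euc (d : ℕ) : Type := EuclideanSpace ℝ (Fin d)

/-- Supremum over `s` of the norm of the `i`-th iterated (Fréchet) derivative of `f`. -/
noncomputable def supDeriv {d : ℕ} {F : Type*} [NormedAddCommGroup F] [NormedSpace ℝ F]
    (i : ℕ) (f : Euc d → F) (s : Set (Euc d)) : ℝ :=
  sSup ((fun x => ‖iteratedFDeriv ℝ i f x‖) '' s)

/-- The `C^k` norm of `f` on the set `s` (`k` a natural number):
sum of the sup-norms of all derivatives of order up to `k`. -/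
noncomputable def CnormNat {d : ℕ} {F : Type*} [NormedAddCommGroup F] [NormedSpace ℝ F]
    (k : ℕ) (f : Euc d → F) (s : Set (Euc d)) : ℝ :=
  ∑ j ∈ Finset.range (k + 1), supDeriv j f s

/-- The quantity `𝒫_r` (integer `r`): sizes of all derivatives of `Φ` of orders `2,…,r` on `s`. -/
noncomputable def Pnorm {d : ℕ} (r : ℕ) (Φ : Euc d → ℝ) (s : Set (Euc d)) : ℝ :=
  ∑ j ∈ Finset.Icc 2 r, supDeriv j Φ s

/-- The Hessian matrix of `Φ` at `x`. -/
noncomputable def Hess {d : ℕ} (Φ : Euc d → ℝ) (x : Euc d) : Matrix (Fin d) (Fin d) ℝ :=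
  Matrix.of fun i j =>
    iteratedFDeriv ℝ 2 Φ x ![EuclideanSpace.single i (1 : ℝ), EuclideanSpace.single j (1 : ℝ)]

/-- `L^*(Φ) = inf_{x ∈ s} |det HΦ(x)|`. -/
noncomputable def LStar {d : ℕ} (Φ : Euc d → ℝ) (s : Set (Euc d)) : ℝ :=
  sInf ((fun x => |(Hess Φ x).det|) '' s)

/-- The oscillatory integral `I(λ, Φ, ψ) = ∫ e^{iλΦ(x)} ψ(x) dx`. -/
noncomputable def oscInt {d : ℕ} (lam : ℝ) (Φ : Euc d → ℝ) (ψ : Euc d → ℂ) : ℂ :=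
  ∫ x : Euc d, Complex.exp (Complex.I * (lam : ℂ) * (Φ x : ℂ)) * ψ x

lemma bddAbove_norm_iteratedFDeriv_ball {d : ℕ} {F : Type*} [NormedAddCommGroup F]
    [NormedSpace ℝ F] {f : Euc d → F} {U : Set (Euc d)} {n i : ℕ} (hU : IsOpen U)
    (hBU : closedBall 0 1 ⊆ U) (hf : ContDiffOn ℝ n f U) (hi : i ≤ n) :
    BddAbove ((fun x => ‖iteratedFDeriv ℝ i f x‖) '' ball 0 1) := by
  have hc : ContinuousOn (iteratedFDeriv ℝ i f) U :=
    (hf.continuousOn_iteratedFDerivWithin (by exact_mod_cast hi) hU.uniqueDiffOn).congr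
      fun x hx => (iteratedFDerivWithin_of_isOpen i hU hx).symm
  exact ((isCompact_closedBall _ _).bddAbove_image (hc.mono hBU).norm).mono
    (image_mono ball_subset_closedBall)

lemma norm_iteratedFDeriv_le_supDeriv {d : ℕ} {F : Type*} [NormedAddCommGroup F]
    [NormedSpace ℝ F] {f : Euc d → F} {U : Set (Euc d)} {n i : ℕ} (hU : IsOpen U)
    (hBU : closedBall 0 1 ⊆ U) (hf : ContDiffOn ℝ n f U) (hi : i ≤ n) {x : Euc d}
    (hx : x ∈ ball 0 1) : ‖iteratedFDeriv ℝ i f x‖ ≤ supDeriv i f (ball 0 1) :=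
  le_csSup (bddAbove_norm_iteratedFDeriv_ball hU hBU hf hi) (mem_image_of_mem _ hx)

lemma supDeriv_nonneg {d : ℕ} {F : Type*} [NormedAddCommGroup F] [NormedSpace ℝ F]
    (i : ℕ) (f : Euc d → F) (s : Set (Euc d)) : 0 ≤ supDeriv i f s :=
  Real.sSup_nonneg (by rintro _ ⟨x, -, rfl⟩; exact norm_nonneg _)

lemma Pnorm_nonneg {d : ℕ} (r : ℕ) (Φ : Euc d → ℝ) (s : Set (Euc d)) : 0 ≤ Pnorm r Φ s :=
  Finset.sum_nonneg fun _ _ => supDeriv_nonneg _ _ _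

lemma CnormNat_nonneg {d : ℕ} {F : Type*} [NormedAddCommGroup F] [NormedSpace ℝ F]
    (k : ℕ) (f : Euc d → F) (s : Set (Euc d)) : 0 ≤ CnormNat k f s :=
  Finset.sum_nonneg fun _ _ => supDeriv_nonneg _ _ _

lemma supDeriv_le_Pnorm {d r i : ℕ} (h2 : 2 ≤ i) (hr : i ≤ r) (Φ : Euc d → ℝ)
    (s : Set (Euc d)) : supDeriv i Φ s ≤ Pnorm r Φ s :=
  Finset.single_le_sum (f := fun j => supDeriv j Φ s) (fun _ _ => supDeriv_nonneg _ _ _)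
    (Finset.mem_Icc.2 ⟨h2, hr⟩)

lemma supDeriv_le_CnormNat {d k i : ℕ} {F : Type*} [NormedAddCommGroup F] [NormedSpace ℝ F]
    (hi : i ≤ k) (f : Euc d → F) (s : Set (Euc d)) : supDeriv i f s ≤ CnormNat k f s :=
  Finset.single_le_sum (f := fun j => supDeriv j f s) (fun _ _ => supDeriv_nonneg _ _ _)
    (Finset.mem_range.2 (Nat.lt_succ_of_le hi))

lemma norm_iteratedFDeriv_cexp_I_mul (n : ℕ) (t : ℝ) :
    ‖iteratedFDeriv ℝ n (fun s : ℝ => Complex.exp (Complex.I * s)) t‖ = 1 := by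
  have key : ∀ n : ℕ, iteratedDeriv n (fun s : ℝ => Complex.exp (Complex.I * s)) =
      fun s : ℝ => Complex.I ^ n * Complex.exp (Complex.I * s) := by
    intro n
    induction n with
    | zero => simp
    | succ n ih =>
      rw [iteratedDeriv_succ, ih]
      ext s
      have h : HasDerivAt (fun s : ℝ => Complex.exp (Complex.I * s))
          (Complex.exp (Complex.I * s) * (Complex.I * 1)) s :=
        ((Complex.ofRealCLM.hasDerivAt (x := s)).const_mul Complex.I).cexp
      rw [(h.const_mul (Complex.I ^ n)).deriv]
      ring
  rw [norm_iteratedFDeriv_eq_norm_iteratedDeriv, key, norm_mul, norm_pow, Complex.norm_I,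
    mul_comm Complex.I, Complex.norm_exp_ofReal_mul_I]
  simp

/-- A Leibniz rule for derivative bounds which grow geometrically in the order. -/
lemma norm_iteratedFDerivWithin_smul_le_geometric {E : Type*} [NormedAddCommGroup E]
    [NormedSpace ℝ E] {𝕜 F : Type*} [NormedField 𝕜] [NormedAlgebra ℝ 𝕜] [NormedAddCommGroup F]
    [NormedSpace ℝ F] [NormedSpace 𝕜 F] [IsScalarTower ℝ 𝕜 F] {s : Set E} {u : E → 𝕜} {v : E → F}
    {n : ℕ} (hs : UniqueDiffOn ℝ s) (hu : ContDiffOn ℝ n u s) (hv : ContDiffOn ℝ n v s)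
    {x : E} (hx : x ∈ s) {a b B : ℝ} (ha : 0 ≤ a) (hB : 0 ≤ B)
    (hua : ∀ i ≤ n, ‖iteratedFDerivWithin ℝ i u s x‖ ≤ a * B ^ i)
    (hvb : ∀ i ≤ n, ‖iteratedFDerivWithin ℝ i v s x‖ ≤ b * B ^ i) {i : ℕ} (hi : i ≤ n) :
    ‖iteratedFDerivWithin ℝ i (fun y => u y • v y) s x‖ ≤ 2 ^ i * (a * b) * B ^ i := by
  refine (norm_iteratedFDerivWithin_smul_le hu hv hs hx (by exact_mod_cast hi)).trans ?_
  have hsum : (2 : ℝ) ^ i * (a * b) * B ^ i =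
      ∑ j ∈ Finset.range (i + 1), (i.choose j : ℝ) * (a * B ^ j) * (b * B ^ (i - j)) := by
    rw [← Nat.cast_ofNat, ← Nat.cast_pow, ← Nat.sum_range_choose, Nat.cast_sum, Finset.sum_mul,
      Finset.sum_mul]
    refine Finset.sum_congr rfl fun j hj => ?_
    have hji : j ≤ i := Nat.lt_succ_iff.1 (Finset.mem_range.1 hj)
    rw [← Nat.sub_add_cancel hji, pow_add, Nat.sub_add_cancel hji]
    ring
  rw [hsum]
  refine Finset.sum_le_sum fun j hj => ?_
  have hji : j ≤ i := Nat.lt_succ_iff.1 (Finset.mem_range.1 hj)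
  gcongr
  · exact hua j (hji.trans hi)
  · exact hvb _ ((Nat.sub_le _ _).trans hi)

lemma iteratedFDeriv_eq_zero_of_notMem_tsupport {E F : Type*} [NormedAddCommGroup E]
    [NormedSpace ℝ E] [NormedAddCommGroup F] [NormedSpace ℝ F] {f : E → F} {x : E}
    (hx : x ∉ tsupport f) (n : ℕ) : iteratedFDeriv ℝ n f x = 0 :=
  Function.notMem_support.1 fun h => hx (support_iteratedFDeriv_subset n h)

open scoped FourierTransform in
lemma norm_pow_mul_norm_fourier_le {d n : ℕ} {f : Euc d → ℂ} (hf : ContDiff ℝ n f) {y : Euc d}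
    {r K : ℝ} (hsupp : tsupport f ⊆ closedBall y r)
    (hK : ∀ i ≤ n, ∀ x, ‖iteratedFDeriv ℝ i f x‖ ≤ K) (w : Euc d) :
    ‖w‖ ^ n * ‖𝓕 f w‖ ≤ 2 ^ n * ((n + 1) * (volume.real (closedBall y r) * K)) := by
  have hcs : HasCompactSupport f := (isCompact_closedBall y r).of_isClosed_subset
    (isClosed_tsupport f) hsupp
  have hint : ∀ i : ℕ, i ≤ n → Integrable (fun v => ‖iteratedFDeriv ℝ i f v‖) := fun i hi =>
    ((hf.continuous_iteratedFDeriv (by exact_mod_cast hi)).integrable_of_hasCompactSupport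
      (hcs.iteratedFDeriv i)).norm
  have h := Real.pow_mul_norm_iteratedFDeriv_fourier_le (K := 0) (N := n) hf
    (fun k i hk hi => by
      obtain rfl : k = 0 := by simpa using hk
      simpa using hint i (by exact_mod_cast hi)) (k := 0) (n := n) le_rfl le_rfl w
  rw [norm_iteratedFDeriv_zero] at h
  refine h.trans ?_
  simp only [pow_zero, CharP.cast_eq_zero, mul_zero, zero_add, one_mul, Finset.range_one,
    Finset.sum_product, Finset.sum_singleton]
  gcongr
  refine (Finset.sum_le_card_nsmul _ _ (volume.real (closedBall y r) * K) fun i hi => ?_).trans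
    (by simp)
  have hin : i ≤ n := Nat.lt_succ_iff.1 (Finset.mem_range.1 hi)
  rw [← setIntegral_eq_integral_of_forall_compl_eq_zero (s := closedBall y r)]
  · refine (setIntegral_mono_on (hint i hin).integrableOn
      (integrableOn_const measure_closedBall_lt_top.ne) measurableSet_closedBall
      fun x _ => hK i hin x).trans ?_
    simp
  · intro x hx
    rw [iteratedFDeriv_eq_zero_of_notMem_tsupport fun h => hx (hsupp h), norm_zero]

lemma norm_iteratedFDeriv_clm_add_const_le {E F : Type*} [NormedAddCommGroup E]
    [NormedSpace ℝ E] [NormedAddCommGroup F] [NormedSpace ℝ F] (L : E →L[ℝ] F) (c : F) {i : ℕ}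
    (hi : 1 ≤ i) {D : ℝ} (hL : ‖L‖ ≤ D) (x : E) :
    ‖iteratedFDeriv ℝ i (fun y => c + L y) x‖ ≤ D ^ i := by
  have hD : fderiv ℝ (fun y => c + L y) = fun _ => L := by
    ext1 y
    rw [fderiv_const_add, L.fderiv]
  obtain ⟨k, rfl⟩ := Nat.exists_eq_add_of_le' hi
  rw [← norm_iteratedFDeriv_fderiv, hD]
  rcases Nat.eq_zero_or_pos k with rfl | hk
  · simpa using hL
  · rw [iteratedFDeriv_const_of_ne hk.ne']
    simpa using pow_nonneg ((norm_nonneg L).trans hL) _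

/-- After removing its linear part at `y`, the phase `T ^ 2 • Φ` varies at unit scale on the ball of
radius `2 / T` around `y`. -/
lemma norm_iteratedFDeriv_phase_remainder_le {E : Type*} [NormedAddCommGroup E] [NormedSpace ℝ E]
    {Φ : E → ℝ} {S : Set E} {n : ℕ} (hS : IsOpen S) (hconv : Convex ℝ S) (hn : 2 ≤ n)
    (hΦ : ContDiffOn ℝ n Φ S) {P T : ℝ} (hT : 1 ≤ T)
    (hP : ∀ i, 2 ≤ i → i ≤ n → ∀ x ∈ S, ‖iteratedFDeriv ℝ i Φ x‖ ≤ P) {x y : E} (hx : x ∈ S)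
    (hy : y ∈ S) (hxy : T * ‖x - y‖ ≤ 2) {i : ℕ} (h1 : 1 ≤ i) (hi : i ≤ n) :
    ‖iteratedFDeriv ℝ i (fun z => T ^ 2 * (Φ z - fderiv ℝ Φ y z)) x‖ ≤ ((1 + 2 * P) * T) ^ i := by
  have hP0 : 0 ≤ P := (norm_nonneg _).trans (hP 2 le_rfl hn x hx)
  have hdiff : ∀ z ∈ S, DifferentiableAt ℝ Φ z := fun z hz =>
    (hΦ.contDiffAt (hS.mem_nhds hz)).differentiableAt (by simp; omega)
  have hdiff2 : ∀ z ∈ S, DifferentiableAt ℝ (fderiv ℝ Φ) z := fun z hz =>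
    ((hΦ.contDiffAt (hS.mem_nhds hz)).fderiv_right (m := 1)
      (by exact_mod_cast hn)).differentiableAt (by simp)
  have hfd : ∀ z ∈ S, fderiv ℝ (fun z => T ^ 2 * (Φ z - fderiv ℝ Φ y z)) z =
      T ^ 2 • (fderiv ℝ Φ z - fderiv ℝ Φ y) := fun z hz =>
    (((hdiff z hz).hasFDerivAt.sub (fderiv ℝ Φ y).hasFDerivAt).const_mul (T ^ 2)).fderiv
  have hfd2 : ∀ z ∈ S, fderiv ℝ (fderiv ℝ fun z => T ^ 2 * (Φ z - fderiv ℝ Φ y z)) z =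
      T ^ 2 • fderiv ℝ (fderiv ℝ Φ) z := fun z hz => by
    have : fderiv ℝ (fun z => T ^ 2 * (Φ z - fderiv ℝ Φ y z)) =ᶠ[nhds z]
        fun z => T ^ 2 • (fderiv ℝ Φ z - fderiv ℝ Φ y) := by
      filter_upwards [hS.mem_nhds hz] with z hz using hfd z hz
    rw [this.fderiv_eq]
    exact (((hdiff2 z hz).hasFDerivAt.sub_const _).const_smul (T ^ 2)).fderiv
  have hnormfd2 : ∀ z, ‖fderiv ℝ (fderiv ℝ Φ) z‖ = ‖iteratedFDeriv ℝ 2 Φ z‖ := fun z => by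
    rw [← norm_iteratedFDeriv_fderiv, ← norm_iteratedFDeriv_fderiv, norm_iteratedFDeriv_zero]
  obtain rfl | h2 : i = 1 ∨ 2 ≤ i := by omega
  · rw [← norm_iteratedFDeriv_fderiv, norm_iteratedFDeriv_zero, hfd x hx, norm_smul, pow_one]
    have hmv : ‖fderiv ℝ Φ x - fderiv ℝ Φ y‖ ≤ P * ‖x - y‖ :=
      hconv.norm_image_sub_le_of_norm_fderiv_le (fun z hz => hdiff2 z hz)
        (fun z hz => (hnormfd2 z).trans_le (hP 2 le_rfl hn z hz)) hy hx
    rw [Real.norm_of_nonneg (by positivity)]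
    calc T ^ 2 * ‖fderiv ℝ Φ x - fderiv ℝ Φ y‖ ≤ T ^ 2 * (P * ‖x - y‖) := by gcongr
      _ = P * T * (T * ‖x - y‖) := by ring
      _ ≤ P * T * 2 := by gcongr
      _ ≤ (1 + 2 * P) * T := by nlinarith
  · obtain ⟨k, rfl⟩ := Nat.exists_eq_add_of_le' h2
    have hev : fderiv ℝ (fderiv ℝ fun z => T ^ 2 * (Φ z - fderiv ℝ Φ y z)) =ᶠ[nhds x]
        T ^ 2 • fderiv ℝ (fderiv ℝ Φ) := by
      filter_upwards [hS.mem_nhds hx] with z hz using hfd2 z hz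
    have hcd : ContDiffAt ℝ k (fderiv ℝ (fderiv ℝ Φ)) x :=
      ((hΦ.contDiffAt (hS.mem_nhds hx)).fderiv_right (m := (k + 1 : ℕ))
        (by exact_mod_cast hi)).fderiv_right (m := k) (by norm_cast)
    rw [← norm_iteratedFDeriv_fderiv, ← norm_iteratedFDeriv_fderiv,
      (hev.iteratedFDeriv ℝ k).eq_of_nhds, iteratedFDeriv_const_smul_apply hcd, norm_smul,
      norm_iteratedFDeriv_fderiv, norm_iteratedFDeriv_fderiv, Real.norm_of_nonneg (by positivity)]
    calc T ^ 2 * ‖iteratedFDeriv ℝ (k + 1 + 1) Φ x‖ ≤ T ^ (k + 2) * P := by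
          gcongr ?_ * ?_
          · exact pow_le_pow_right₀ hT (by omega)
          · exact hP (k + 2) h2 hi x hx
      _ ≤ T ^ (k + 2) * (1 + 2 * P) ^ (k + 2) := by
          gcongr
          exact (by linarith : P ≤ 1 + 2 * P).trans (le_self_pow₀ (by linarith) (by omega))
      _ = ((1 + 2 * P) * T) ^ (k + 2) := by rw [mul_pow, mul_comm]

/-- The amplitude of the wave packet at position `y` and scale `T⁻¹`. -/
def packetAmplitude {d : ℕ} (g : Euc d → ℝ) (Φ : Euc d → ℝ) (ψ : Euc d → ℂ) (T : ℝ)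
    (y x : Euc d) : ℂ :=
  (g (T • y - (T - 1) • x) : ℂ) •
    (Complex.exp (Complex.I * ((T ^ 2 * (Φ x - fderiv ℝ Φ y x) : ℝ) : ℂ)) • ψ x)

/-- A window seen from a point of the unit ball is centred in the unit ball, and close by. -/
lemma mem_ball_of_window {E : Type*} [NormedAddCommGroup E] [NormedSpace ℝ E] {T : ℝ} (hT : 1 ≤ T)
    {x y : E} (hx : x ∈ ball (0 : E) 1) (hxy : T • y - (T - 1) • x ∈ ball (0 : E) 1) :
    y ∈ ball (0 : E) 1 ∧ T * ‖x - y‖ ≤ 2 := by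
  rw [mem_ball_zero_iff] at *
  have hT0 : 0 < T := by linarith
  constructor
  · have h1 : T * ‖y‖ = ‖(T • y - (T - 1) • x) + (T - 1) • x‖ := by
      rw [sub_add_cancel, norm_smul, Real.norm_of_nonneg hT0.le]
    have h2 := norm_add_le (T • y - (T - 1) • x) ((T - 1) • x)
    rw [← h1, norm_smul, Real.norm_of_nonneg (by linarith : 0 ≤ T - 1)] at h2
    have h3 : (T - 1) * ‖x‖ ≤ (T - 1) * 1 := by gcongr
    by_contra! h
    nlinarith
  · have h1 : T * ‖x - y‖ = ‖x - (T • y - (T - 1) • x)‖ := by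
      rw [← Real.norm_of_nonneg hT0.le, ← norm_smul, Real.norm_of_nonneg hT0.le]
      congr 1
      module
    rw [h1]
    exact (norm_sub_le _ _).trans (by linarith)

variable {d : ℕ} {g : Euc d → ℝ} {Φ : Euc d → ℝ} {ψ : Euc d → ℂ} {T : ℝ} {U : Set (Euc d)}

lemma mem_ball_of_packetAmplitude_ne_zero (hT : 1 ≤ T) (hg : Function.support g ⊆ ball 0 1)
    (hψ : Function.support ψ ⊆ ball 0 1) {x y : Euc d} (h : packetAmplitude g Φ ψ T y x ≠ 0) :
    x ∈ ball 0 1 ∧ y ∈ ball 0 1 ∧ T * ‖x - y‖ ≤ 2 := by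
  have hgx : g (T • y - (T - 1) • x) ≠ 0 := fun h0 => h (by simp [packetAmplitude, h0])
  have hψx : ψ x ≠ 0 := fun h0 => h (by simp [packetAmplitude, h0])
  exact ⟨hψ hψx, mem_ball_of_window hT (hψ hψx) (hg hgx)⟩

lemma tsupport_packetAmplitude_subset (hT : 1 ≤ T) (hg : Function.support g ⊆ ball 0 1)
    (hψ : Function.support ψ ⊆ ball 0 1) (y : Euc d) :
    tsupport (packetAmplitude g Φ ψ T y) ⊆ closedBall 0 1 ∩ closedBall y (2 / T) := by
  refine closure_minimal (fun x hx => ?_) (isClosed_closedBall.inter isClosed_closedBall)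
  obtain ⟨hx, -, hxy⟩ := mem_ball_of_packetAmplitude_ne_zero hT hg hψ hx
  refine ⟨ball_subset_closedBall hx, ?_⟩
  rwa [mem_closedBall, dist_eq_norm, le_div_iff₀ (by linarith), mul_comm]

lemma contDiffOn_packetAmplitude {n : ℕ} (hgn : ContDiff ℝ n g) (hΦ : ContDiffOn ℝ n Φ U)
    (hψn : ContDiff ℝ n ψ) (y : Euc d) : ContDiffOn ℝ n (packetAmplitude g Φ ψ T y) U := by
  have h1 : ContDiff ℝ n fun x => ((g (T • y - (T - 1) • x) : ℝ) : ℂ) :=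
    Complex.ofRealCLM.contDiff.comp (hgn.comp (by fun_prop))
  have h2 : ContDiffOn ℝ n (fun x => ((T ^ 2 * (Φ x - fderiv ℝ Φ y x) : ℝ) : ℂ)) U :=
    Complex.ofRealCLM.contDiff.comp_contDiffOn
      (contDiffOn_const.mul (hΦ.sub (fderiv ℝ Φ y).contDiff.contDiffOn))
  exact h1.contDiffOn.smul ((contDiffOn_const.mul h2).cexp.smul hψn.contDiffOn)

lemma contDiff_packetAmplitude {n : ℕ} (hU : IsOpen U) (hBU : closedBall 0 1 ⊆ U) (hT : 1 ≤ T)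
    (hg : Function.support g ⊆ ball 0 1) (hψ : Function.support ψ ⊆ ball 0 1)
    (hgn : ContDiff ℝ n g) (hΦ : ContDiffOn ℝ n Φ U) (hψn : ContDiff ℝ n ψ) (y : Euc d) :
    ContDiff ℝ n (packetAmplitude g Φ ψ T y) :=
  contDiff_iff_contDiffAt.2 fun x => by
    by_cases hx : x ∈ tsupport (packetAmplitude g Φ ψ T y)
    · exact (contDiffOn_packetAmplitude hgn hΦ hψn y).contDiffAt
        (hU.mem_nhds (hBU (tsupport_packetAmplitude_subset hT hg hψ y hx).1))
    · exact contDiffAt_const.congr_of_eventuallyEq (notMem_tsupport_iff_eventuallyEq.1 hx)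

open Nat in
lemma norm_iteratedFDeriv_window_le {n : ℕ} (hT : 1 ≤ T) (hgn : ContDiff ℝ n g) {G : ℝ}
    (hG : ∀ i ≤ n, ∀ x, ‖iteratedFDeriv ℝ i g x‖ ≤ G) (x y : Euc d) :
    ‖iteratedFDeriv ℝ n (fun z => ((g (T • y - (T - 1) • z) : ℝ) : ℂ)) x‖ ≤ n ! * G * T ^ n := by
  have hgC : ContDiff ℝ n fun z => ((g z : ℝ) : ℂ) := Complex.ofRealCLM.contDiff.comp hgn
  have hwin : ContDiff ℝ n fun z : Euc d =>
      T • y + (-(T - 1) • ContinuousLinearMap.id ℝ (Euc d)) z := by fun_prop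
  have hcomp : (fun z => ((g (T • y - (T - 1) • z) : ℝ) : ℂ)) = (fun z => ((g z : ℝ) : ℂ)) ∘
      fun z : Euc d => T • y + (-(T - 1) • ContinuousLinearMap.id ℝ (Euc d)) z := by
    ext z
    simp only [Function.comp_apply, smul_apply, ContinuousLinearMap.id_apply, neg_smul,
      ← sub_eq_add_neg]
  rw [hcomp]
  refine norm_iteratedFDeriv_comp_le (C := G) (D := T) hgC hwin le_rfl x
    (fun k hk => ?_) fun k h1 hk => ?_
  · exact (LinearIsometry.norm_iteratedFDeriv_comp_left Complex.ofRealLI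
      hgn.contDiffAt (by exact_mod_cast hk)).trans_le (hG k hk _)
  · refine norm_iteratedFDeriv_clm_add_const_le _ _ h1 ?_ _
    rw [norm_smul, norm_neg, Real.norm_of_nonneg (by linarith)]
    exact (mul_le_of_le_one_right (by linarith) ContinuousLinearMap.norm_id_le).trans
      (by linarith)

open Nat in
lemma norm_iteratedFDerivWithin_cexp_I_mul_le {E : Type*} [NormedAddCommGroup E]
    [NormedSpace ℝ E] {R : E → ℝ} {s : Set E} {n : ℕ} (hs : UniqueDiffOn ℝ s)
    (hR : ContDiffOn ℝ n R s) {x : E} (hx : x ∈ s) {B : ℝ}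
    (hB : ∀ i, 1 ≤ i → i ≤ n → ‖iteratedFDerivWithin ℝ i R s x‖ ≤ B ^ i) :
    ‖iteratedFDerivWithin ℝ n (fun z => Complex.exp (Complex.I * (R z : ℂ))) s x‖ ≤
      n ! * B ^ n := by
  have hE : ContDiff ℝ n fun t : ℝ => Complex.exp (Complex.I * t) :=
    (contDiff_const.mul Complex.ofRealCLM.contDiff).cexp
  refine (norm_iteratedFDerivWithin_comp_le (C := 1) (D := B) hE.contDiffOn hR le_rfl
    uniqueDiffOn_univ hs (mapsTo_univ _ _) hx (fun k _ => ?_) hB).trans_eq (by rw [mul_one])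
  rw [iteratedFDerivWithin_univ, norm_iteratedFDeriv_cexp_I_mul]

open Nat in
lemma norm_iteratedFDeriv_packetAmplitude_le_of_mem_ball {n : ℕ} (hn : 2 ≤ n) (hU : IsOpen U)
    (hBU : closedBall 0 1 ⊆ U) (hT : 1 ≤ T) (hgn : ContDiff ℝ n g) (hΦ : ContDiffOn ℝ n Φ U)
    (hψn : ContDiff ℝ n ψ) {G : ℝ} (hG : ∀ i ≤ n, ∀ x, ‖iteratedFDeriv ℝ i g x‖ ≤ G)
    {x y : Euc d} (hx : x ∈ ball 0 1) (hy : y ∈ ball 0 1) (hxy : T * ‖x - y‖ ≤ 2)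
    {i : ℕ} (hi : i ≤ n) :
    ‖iteratedFDeriv ℝ i (packetAmplitude g Φ ψ T y) x‖ ≤
      4 ^ i * ((n ! : ℝ) ^ 2 * G * CnormNat n ψ (ball 0 1)) *
        ((1 + 2 * Pnorm n Φ (ball 0 1)) * T) ^ i := by
  set A := CnormNat n ψ (ball 0 1)
  set P := Pnorm n Φ (ball 0 1)
  have hA0 : 0 ≤ A := CnormNat_nonneg _ _ _
  have hP0 : 0 ≤ P := Pnorm_nonneg _ _ _
  have hG0 : 0 ≤ G := (norm_nonneg _).trans (hG 0 (Nat.zero_le _) 0)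
  set B := (1 + 2 * P) * T with hB
  have hTB : T ≤ B := by nlinarith
  have hB1 : 1 ≤ B := hT.trans hTB
  have hS : IsOpen (ball (0 : Euc d) 1) := isOpen_ball
  have hud := hS.uniqueDiffOn (𝕜 := ℝ)
  have hΦB : ContDiffOn ℝ n Φ (ball 0 1) := hΦ.mono (ball_subset_closedBall.trans hBU)
  have hfact : ∀ j ≤ n, (j ! : ℝ) ≤ n ! := fun j hj => by exact_mod_cast Nat.factorial_le hj
  have hle : ∀ j ≤ n, (j : WithTop ℕ∞) ≤ n := fun j hj => by exact_mod_cast hj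
  have hψb : ∀ j ≤ n, ‖iteratedFDerivWithin ℝ j ψ (ball 0 1) x‖ ≤ A * B ^ j := fun j hj => by
    rw [iteratedFDerivWithin_of_isOpen j hS hx]
    exact ((norm_iteratedFDeriv_le_supDeriv isOpen_univ (subset_univ _) hψn.contDiffOn hj hx).trans
      (supDeriv_le_CnormNat hj _ _)).trans (le_mul_of_one_le_right hA0 (one_le_pow₀ hB1))
  have hRn : ContDiffOn ℝ n (fun z => T ^ 2 * (Φ z - fderiv ℝ Φ y z)) (ball 0 1) :=
    contDiffOn_const.mul (hΦB.sub (fderiv ℝ Φ y).contDiff.contDiffOn)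
  set e : Euc d → ℂ := fun z =>
    Complex.exp (Complex.I * ((T ^ 2 * (Φ z - fderiv ℝ Φ y z) : ℝ) : ℂ)) with he
  have hen : ContDiffOn ℝ n e (ball 0 1) :=
    (contDiffOn_const.mul (Complex.ofRealCLM.contDiff.comp_contDiffOn hRn)).cexp
  have heb : ∀ j ≤ n, ‖iteratedFDerivWithin ℝ j e (ball 0 1) x‖ ≤ n ! * B ^ j := fun j hj => by
    refine (norm_iteratedFDerivWithin_cexp_I_mul_le (B := B) hud (hRn.of_le (hle j hj)) hx
      fun k h1 hk => ?_).trans (mul_le_mul_of_nonneg_right (hfact j hj) (by positivity))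
    rw [iteratedFDerivWithin_of_isOpen k hS hx]
    exact norm_iteratedFDeriv_phase_remainder_le hS (convex_ball _ _) hn hΦB hT
      (fun l hl hln z hz => (norm_iteratedFDeriv_le_supDeriv hU hBU hΦ hln hz).trans
        (supDeriv_le_Pnorm hl hln _ _)) hx hy hxy h1 (hk.trans hj)
  set w : Euc d → ℂ := fun z => ((g (T • y - (T - 1) • z) : ℝ) : ℂ) with hw
  have hwn : ContDiff ℝ n w := Complex.ofRealCLM.contDiff.comp (hgn.comp (by fun_prop))
  have hwb : ∀ j ≤ n, ‖iteratedFDerivWithin ℝ j w (ball 0 1) x‖ ≤ (n ! * G) * B ^ j :=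
    fun j hj => by
    rw [iteratedFDerivWithin_of_isOpen j hS hx]
    refine (norm_iteratedFDeriv_window_le hT (hgn.of_le (hle j hj))
      (fun k hk => hG k (hk.trans hj)) x y).trans ?_
    have := hfact j hj
    gcongr
  have heψ : ∀ j ≤ n, ‖iteratedFDerivWithin ℝ j (fun z => e z • ψ z) (ball 0 1) x‖ ≤
      2 ^ j * (n ! * A) * B ^ j := fun j hj =>
    norm_iteratedFDerivWithin_smul_le_geometric hud hen hψn.contDiffOn hx (by positivity)
      (by linarith) heb hψb hj
  have hfull := norm_iteratedFDerivWithin_smul_le_geometric hud (hwn.contDiffOn.of_le (hle i hi))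
    ((hen.smul hψn.contDiffOn).of_le (hle i hi)) hx (a := n ! * G) (b := 2 ^ i * (n ! * A))
    (B := B) (by positivity) (by linarith) (fun j hj => hwb j (hj.trans hi))
    (fun j hj => (heψ j (hj.trans hi)).trans ?_) le_rfl
  · rw [iteratedFDerivWithin_of_isOpen i hS hx] at hfull
    refine hfull.trans_eq ?_
    rw [show (4 : ℝ) ^ i = 2 ^ i * 2 ^ i by rw [← mul_pow]; norm_num]
    ring
  · gcongr
    norm_num

open Nat in
lemma norm_iteratedFDeriv_packetAmplitude_le {n : ℕ} (hn : 2 ≤ n) (hU : IsOpen U)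
    (hBU : closedBall 0 1 ⊆ U) (hT : 1 ≤ T)
    (hg : Function.support g ⊆ ball 0 1) (hψ : Function.support ψ ⊆ ball 0 1)
    (hgn : ContDiff ℝ n g) (hΦ : ContDiffOn ℝ n Φ U) (hψn : ContDiff ℝ n ψ)
    {G : ℝ} (hG : ∀ i ≤ n, ∀ x, ‖iteratedFDeriv ℝ i g x‖ ≤ G) {y : Euc d} (hy : y ∈ ball 0 1)
    {i : ℕ} (hi : i ≤ n) (x : Euc d) :
    ‖iteratedFDeriv ℝ i (packetAmplitude g Φ ψ T y) x‖ ≤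
      4 ^ i * ((n ! : ℝ) ^ 2 * G * CnormNat n ψ (ball 0 1)) *
        ((1 + 2 * Pnorm n Φ (ball 0 1)) * T) ^ i := by
  set K := 4 ^ i * ((n ! : ℝ) ^ 2 * G * CnormNat n ψ (ball 0 1)) *
    ((1 + 2 * Pnorm n Φ (ball 0 1)) * T) ^ i with hK
  have hK0 : 0 ≤ K := by
    have := CnormNat_nonneg n ψ (ball 0 1)
    have := Pnorm_nonneg n Φ (ball 0 1)
    have := (norm_nonneg _).trans (hG 0 (Nat.zero_le _) 0)
    positivity
  have hcont : Continuous (iteratedFDeriv ℝ i (packetAmplitude g Φ ψ T y)) :=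
    (contDiff_packetAmplitude hU hBU hT hg hψ hgn hΦ hψn y).continuous_iteratedFDeriv
      (by exact_mod_cast hi)
  have hout : ∀ z ∉ tsupport (packetAmplitude g Φ ψ T y),
      ‖iteratedFDeriv ℝ i (packetAmplitude g Φ ψ T y) z‖ ≤ K := fun z hz => by
    rwa [iteratedFDeriv_eq_zero_of_notMem_tsupport hz, norm_zero]
  have hball : ball (0 : Euc d) 1 ⊆
      {z | ‖iteratedFDeriv ℝ i (packetAmplitude g Φ ψ T y) z‖ ≤ K} := fun z hz => by
    by_cases hzs : z ∈ tsupport (packetAmplitude g Φ ψ T y)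
    · have hzy := (tsupport_packetAmplitude_subset hT hg hψ y hzs).2
      rw [mem_closedBall, dist_eq_norm, le_div_iff₀ (by linarith), mul_comm] at hzy
      exact norm_iteratedFDeriv_packetAmplitude_le_of_mem_ball hn hU hBU hT hgn hΦ hψn hG hz hy
        hzy hi
    · exact hout z hzs
  by_cases hxs : x ∈ tsupport (packetAmplitude g Φ ψ T y)
  · have hcl := closure_minimal hball (isClosed_le hcont.norm continuous_const)
    rw [closure_ball _ one_ne_zero] at hcl
    exact hcl (tsupport_packetAmplitude_subset hT hg hψ y hxs).1
  · exact hout x hxs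

open scoped FourierTransform in
lemma integral_packet_eq_fourier (g : Euc d → ℝ) (Φ : Euc d → ℝ) (ψ : Euc d → ℂ)
    (T : ℝ) (y : Euc d) :
    ∫ x, Complex.exp (Complex.I * ((T ^ 2 : ℝ) : ℂ) * Φ x) * ψ x * g (T • y - (T - 1) • x) =
      𝓕 (packetAmplitude g Φ ψ T y) (-(T ^ 2 / (2 * Real.pi)) • gradient Φ y) := by
  rw [Real.fourier_eq']
  congr 1
  ext x
  have hgrad : inner ℝ x (gradient Φ y) = fderiv ℝ Φ y x := by
    rw [real_inner_comm, gradient, InnerProductSpace.toDual_symm_apply]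
  have hphase : -2 * Real.pi * inner ℝ x (-(T ^ 2 / (2 * Real.pi)) • gradient Φ y) =
      T ^ 2 * fderiv ℝ Φ y x := by
    rw [inner_smul_right, hgrad]
    field_simp
  rw [hphase]
  have hexp : Complex.exp (Complex.I * ((T ^ 2 : ℝ) : ℂ) * Φ x) =
      Complex.exp (((T ^ 2 * fderiv ℝ Φ y x : ℝ) : ℂ) * Complex.I) *
        Complex.exp (Complex.I * ((T ^ 2 * (Φ x - fderiv ℝ Φ y x) : ℝ) : ℂ)) := by
    rw [← Complex.exp_add]
    congr 1
    push_cast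
    ring
  rw [hexp]
  simp only [packetAmplitude, smul_eq_mul]
  ring

open Nat in
/-- A packet at `y` is negligible unless the phase is nearly stationary at `y`. -/
lemma norm_packet_mul_pow_le {n k : ℕ} (hn : 2 ≤ n) (hk : k ≤ n) (hU : IsOpen U)
    (hBU : closedBall 0 1 ⊆ U) (hT : 1 ≤ T)
    (hg : Function.support g ⊆ ball 0 1) (hψ : Function.support ψ ⊆ ball 0 1)
    (hgn : ContDiff ℝ n g) (hΦ : ContDiffOn ℝ n Φ U) (hψn : ContDiff ℝ n ψ)
    {G : ℝ} (hG : ∀ i ≤ n, ∀ x, ‖iteratedFDeriv ℝ i g x‖ ≤ G) {y : Euc d} (hy : y ∈ ball 0 1) :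
    (T * ‖gradient Φ y‖) ^ k *
      ‖∫ x, Complex.exp (Complex.I * ((T ^ 2 : ℝ) : ℂ) * Φ x) * ψ x *
        g (T • y - (T - 1) • x)‖ ≤
      (16 * Real.pi) ^ n * (n + 1) * (n ! : ℝ) ^ 2 * G * 2 ^ d *
        volume.real (closedBall (0 : Euc d) 1) * CnormNat n ψ (ball 0 1) *
        (1 + 2 * Pnorm n Φ (ball 0 1)) ^ n * (T ^ d)⁻¹ := by
  set A := CnormNat n ψ (ball 0 1)
  set P := Pnorm n Φ (ball 0 1)
  set V := volume.real (closedBall (0 : Euc d) 1)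
  have hA0 : 0 ≤ A := CnormNat_nonneg _ _ _
  have hP0 : 0 ≤ P := Pnorm_nonneg _ _ _
  have hV0 : 0 ≤ V := measureReal_nonneg
  have hG0 : 0 ≤ G := (norm_nonneg _).trans (hG 0 (Nat.zero_le _) 0)
  have hT0 : 0 < T := by linarith
  have hB1 : 1 ≤ (1 + 2 * P) * T := one_le_mul_of_one_le_of_one_le (by linarith) hT
  have hpi := Real.pi_pos
  have hle : ∀ i ≤ n, (i : WithTop ℕ∞) ≤ n := fun j hj => by exact_mod_cast hj
  have hvol : volume.real (closedBall y (2 / T)) = 2 ^ d * (T ^ d)⁻¹ * V := by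
    rw [Measure.addHaar_real_closedBall' _ _ (by positivity), finrank_euclideanSpace_fin, div_pow,
      div_eq_mul_inv]
  rw [integral_packet_eq_fourier]
  set w : Euc d := -(T ^ 2 / (2 * Real.pi)) • gradient Φ y with hw
  have hwnorm : (T * ‖gradient Φ y‖) = 2 * Real.pi * T⁻¹ * ‖w‖ := by
    rw [hw, norm_smul, norm_neg, Real.norm_of_nonneg (by positivity)]
    field_simp
  have hmain := norm_pow_mul_norm_fourier_le
    ((contDiff_packetAmplitude hU hBU hT hg hψ hgn hΦ hψn y).of_le (hle k hk))
    ((tsupport_packetAmplitude_subset hT hg hψ y).trans inter_subset_right)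
    (K := 4 ^ k * ((n ! : ℝ) ^ 2 * G * A) * ((1 + 2 * P) * T) ^ k)
    (fun i hi x => (norm_iteratedFDeriv_packetAmplitude_le hn hU hBU hT hg hψ hgn hΦ hψn hG hy
      (hi.trans hk) x).trans (by gcongr; norm_num)) w
  rw [hwnorm, mul_pow _ ‖w‖, mul_assoc]
  calc _ ≤ (2 * Real.pi * T⁻¹) ^ k * (2 ^ k * ((k + 1) * (volume.real (closedBall y (2 / T)) *
        (4 ^ k * ((n ! : ℝ) ^ 2 * G * A) * ((1 + 2 * P) * T) ^ k)))) := by gcongr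
    _ = (16 * Real.pi) ^ k * (k + 1) * (n ! : ℝ) ^ 2 * G * 2 ^ d * V * A *
        (1 + 2 * P) ^ k * (T ^ d)⁻¹ := by
      rw [hvol, show (16 : ℝ) * Real.pi = 2 * Real.pi * (2 * 4) by ring]
      have hTk : T⁻¹ ^ k * T ^ k = 1 := by rw [← mul_pow, inv_mul_cancel₀ hT0.ne', one_pow]
      simp only [mul_pow]
      linear_combination (2 ^ k * Real.pi ^ k * (2 ^ k * ((k + 1) * (2 ^ d * (T ^ d)⁻¹ * V *
        (4 ^ k * ((n ! : ℝ) ^ 2 * G * A) * (1 + 2 * P) ^ k))))) * hTk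
    _ ≤ _ := by
      have h16 : 1 ≤ 16 * Real.pi := by linarith [Real.pi_gt_three]
      have hP1 : 1 ≤ 1 + 2 * P := by linarith
      gcongr

lemma one_add_pow_le_two_pow_mul {t : ℝ} (ht : 0 ≤ t) (n : ℕ) :
    (1 + t) ^ n ≤ 2 ^ n * (1 + t ^ n) := by
  refine (add_pow_le zero_le_one ht n).trans ?_
  rw [one_pow]
  gcongr
  · norm_num
  · omega

lemma one_add_two_mul_pow_le {P : ℝ} (hP : 0 ≤ P) {n m : ℕ} (h : n ≤ m) :
    (1 + 2 * P) ^ n ≤ 3 ^ n * (1 + P ^ m) := by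
  rcases le_total P 1 with h1 | h1
  · calc (1 + 2 * P) ^ n ≤ 3 ^ n := by gcongr; linarith
      _ ≤ 3 ^ n * (1 + P ^ m) := le_mul_of_one_le_right (by positivity) (by simp; positivity)
  · calc (1 + 2 * P) ^ n ≤ (3 * P) ^ n := by gcongr; linarith
      _ = 3 ^ n * P ^ n := mul_pow _ _ _
      _ ≤ 3 ^ n * (1 + P ^ m) := by
        gcongr
        exact (pow_le_pow_right₀ h1 h).trans (by linarith)

open Nat in
lemma norm_packet_le {n : ℕ} (hn : 2 ≤ n) (hU : IsOpen U)
    (hBU : closedBall 0 1 ⊆ U) (hT : 1 ≤ T)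
    (hg : Function.support g ⊆ ball 0 1) (hψ : Function.support ψ ⊆ ball 0 1)
    (hgn : ContDiff ℝ n g) (hΦ : ContDiffOn ℝ n Φ U) (hψn : ContDiff ℝ n ψ)
    {G : ℝ} (hG : ∀ i ≤ n, ∀ x, ‖iteratedFDeriv ℝ i g x‖ ≤ G) {y : Euc d} (hy : y ∈ ball 0 1) :
    ‖∫ x, Complex.exp (Complex.I * ((T ^ 2 : ℝ) : ℂ) * Φ x) * ψ x * g (T • y - (T - 1) • x)‖ ≤
      2 * 2 ^ n * ((16 * Real.pi) ^ n * (n + 1) * (n ! : ℝ) ^ 2 * G * 2 ^ d *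
        volume.real (closedBall (0 : Euc d) 1) * CnormNat n ψ (ball 0 1) *
        (1 + 2 * Pnorm n Φ (ball 0 1)) ^ n * (T ^ d)⁻¹) *
      ((1 + T * ‖gradient Φ y‖) ^ n)⁻¹ := by
  have h0 := norm_packet_mul_pow_le hn (Nat.zero_le n) hU hBU hT hg hψ hgn hΦ hψn hG hy
  have h1 := norm_packet_mul_pow_le hn le_rfl hU hBU hT hg hψ hgn hΦ hψn hG hy
  rw [pow_zero, one_mul] at h0
  have ht : 0 ≤ T * ‖gradient Φ y‖ := by positivity
  rw [← div_eq_mul_inv, le_div_iff₀ (by positivity), mul_comm]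
  refine (mul_le_mul_of_nonneg_right (one_add_pow_le_two_pow_mul ht n) (norm_nonneg _)).trans ?_
  rw [mul_assoc, mul_comm (2 : ℝ), mul_assoc]
  refine mul_le_mul_of_nonneg_left ?_ (by positivity)
  linarith

/-- The inverse of the Riesz isomorphism of a real Euclidean space, as a linear map. -/
def rieszSymm (d : ℕ) : (Euc d →L[ℝ] ℝ) →L[ℝ] Euc d :=
  LinearMap.toContinuousLinearMap
    { toFun := (InnerProductSpace.toDual ℝ (Euc d)).symm
      map_add' := map_add _
      map_smul' := fun c L => by simp }

lemma inner_rieszSymm (L : Euc d →L[ℝ] ℝ) (x : Euc d) : inner ℝ (rieszSymm d L) x = L x :=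
  InnerProductSpace.toDual_symm_apply

lemma hasFDerivAt_gradient {x : Euc d} (hΦ : ContDiffAt ℝ 2 Φ x) :
    HasFDerivAt (gradient Φ) (rieszSymm d ∘L fderiv ℝ (fderiv ℝ Φ) x) x :=
  (rieszSymm d).hasFDerivAt.comp x
    ((hΦ.fderiv_right (m := 1) (by norm_num)).differentiableAt (by simp)).hasFDerivAt

lemma det_fderiv_gradient {x : Euc d} (hΦ : ContDiffAt ℝ 2 Φ x) :
    (fderiv ℝ (gradient Φ) x).det = (Hess Φ x).det := by
  rw [(hasFDerivAt_gradient hΦ).fderiv, ContinuousLinearMap.det,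
    ← LinearMap.det_toMatrix (EuclideanSpace.basisFun (Fin d) ℝ).toBasis, ← Matrix.det_transpose]
  congr 1
  ext i j
  rw [Matrix.transpose_apply, LinearMap.toMatrix_apply, Hess, Matrix.of_apply,
    iteratedFDeriv_two_apply]
  rw [OrthonormalBasis.coe_toBasis_repr_apply, OrthonormalBasis.repr_apply_apply]
  simp only [OrthonormalBasis.coe_toBasis, EuclideanSpace.basisFun_apply]
  rw [real_inner_comm]
  exact inner_rieszSymm _ _

lemma LStar_le_abs_det {s : Set (Euc d)} {x : Euc d} (hx : x ∈ s) :
    LStar Φ s ≤ |(Hess Φ x).det| :=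
  csInf_le ⟨0, by rintro _ ⟨y, -, rfl⟩; exact abs_nonneg _⟩ (mem_image_of_mem _ hx)

/-- The gradient is a good change of variables: `det HΦ` pays for its Jacobian. -/
lemma integrableOn_and_integral_abs_det_le {n : ℕ} (hn : d < n) (hT : 0 < T)
    (hΦ : ∀ x ∈ ball (0 : Euc d) 1, ContDiffAt ℝ 2 Φ x)
    (hinj : InjOn (gradient Φ) (ball 0 1)) :
    IntegrableOn (fun y => |(Hess Φ y).det| * ((1 + T * ‖gradient Φ y‖) ^ n)⁻¹) (ball 0 1) ∧
      ∫ y in ball 0 1, |(Hess Φ y).det| * ((1 + T * ‖gradient Φ y‖) ^ n)⁻¹ ≤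
        (T ^ d)⁻¹ * ∫ w : Euc d, ((1 + ‖w‖) ^ n)⁻¹ := by
  have hfd : ∀ y ∈ ball (0 : Euc d) 1,
      HasFDerivWithinAt (gradient Φ) (fderiv ℝ (gradient Φ) y) (ball 0 1) y := fun y hy =>
    (hasFDerivAt_gradient (hΦ y hy)).differentiableAt.hasFDerivAt.hasFDerivWithinAt
  have hint1 : Integrable fun w : Euc d => ((1 + ‖w‖) ^ n)⁻¹ := by
    refine (integrable_one_add_norm (μ := volume) (E := Euc d) (r := n)
      (by rw [finrank_euclideanSpace_fin]; exact_mod_cast hn)).congr (ae_of_all _ fun w => ?_)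
    simp only
    rw [Real.rpow_neg (by positivity), Real.rpow_natCast]
  have hsmul : ∀ w : Euc d, (1 + T * ‖w‖) = 1 + ‖T • w‖ := fun w => by
    rw [norm_smul, Real.norm_of_nonneg hT.le]
  have hint : Integrable fun w : Euc d => ((1 + T * ‖w‖) ^ n)⁻¹ := by
    simp only [hsmul]
    exact hint1.comp_smul hT.ne'
  have hcongr : ∀ y ∈ ball (0 : Euc d) 1,
      |(fderiv ℝ (gradient Φ) y).det| • ((1 + T * ‖gradient Φ y‖) ^ n)⁻¹ =
        |(Hess Φ y).det| * ((1 + T * ‖gradient Φ y‖) ^ n)⁻¹ := fun y hy => by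
    rw [det_fderiv_gradient (hΦ y hy), smul_eq_mul]
  constructor
  · exact ((integrableOn_image_iff_integrableOn_abs_det_fderiv_smul volume measurableSet_ball hfd
      hinj fun w => ((1 + T * ‖w‖) ^ n)⁻¹).1 hint.integrableOn).congr_fun hcongr measurableSet_ball
  · rw [← setIntegral_congr_fun measurableSet_ball hcongr,
      ← integral_image_eq_integral_abs_det_fderiv_smul volume measurableSet_ball hfd hinj
        fun w => ((1 + T * ‖w‖) ^ n)⁻¹]
    refine (setIntegral_le_integral hint (ae_of_all _ fun w => by positivity)).trans_eq ?_
    simp only [hsmul]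
    rw [Measure.integral_comp_smul volume (fun w : Euc d => ((1 + ‖w‖) ^ n)⁻¹) T,
      finrank_euclideanSpace_fin, abs_of_nonneg (by positivity), smul_eq_mul]

/-- Decomposition of a function supported in the unit ball into packets centred in the ball. -/
lemma integral_mul_integral_eq_integral_packets {h : Euc d → ℂ} (hT : 1 ≤ T)
    (hg : Function.support g ⊆ ball 0 1) (hgc : Continuous g)
    (hh : Function.support h ⊆ ball 0 1) (hhc : Continuous h) :
    ((∫ u, g u : ℝ) : ℂ) * ∫ x, h x =
      (T : ℂ) ^ d * ∫ y, ∫ x, h x * (g (T • y - (T - 1) • x) : ℂ) := by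
  have hT0 : 0 < T := by linarith
  have hcont : Continuous (Function.uncurry fun y x : Euc d =>
      h x * (g (T • y - (T - 1) • x) : ℂ)) := by
    unfold Function.uncurry
    fun_prop
  have hsupp : HasCompactSupport (Function.uncurry fun y x : Euc d =>
      h x * (g (T • y - (T - 1) • x) : ℂ)) := by
    refine HasCompactSupport.intro
      ((isCompact_closedBall (0 : Euc d) 1).prod (isCompact_closedBall (0 : Euc d) 1)) ?_
    rintro ⟨y, x⟩ hyx
    by_contra hne
    have hx : x ∈ ball (0 : Euc d) 1 := hh fun h0 => hne (by simp [Function.uncurry, h0])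
    have hw : T • y - (T - 1) • x ∈ ball (0 : Euc d) 1 :=
      hg fun h0 => hne (by simp [Function.uncurry, h0])
    exact hyx ⟨ball_subset_closedBall (mem_ball_of_window hT hx hw).1, ball_subset_closedBall hx⟩
  rw [integral_integral_swap_of_hasCompactSupport hcont hsupp]
  have hinner : ∀ x, ∫ y, h x * (g (T • y - (T - 1) • x) : ℂ) =
      h x * (((T ^ d)⁻¹ * ∫ u, g u : ℝ) : ℂ) := fun x => by
    rw [integral_const_mul, integral_complex_ofReal,
      Measure.integral_comp_smul volume (fun u => g (u - (T - 1) • x)) T,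
      integral_sub_right_eq_self g, finrank_euclideanSpace_fin, abs_of_nonneg (by positivity),
      smul_eq_mul]
  simp only [hinner]
  rw [integral_mul_const]
  have hTd : (T : ℂ) ^ d ≠ 0 := pow_ne_zero _ (by exact_mod_cast hT0.ne')
  push_cast
  field_simp

open Nat in
lemma integral_mul_norm_oscInt_le {n : ℕ} (hn : 2 ≤ n) (hdn : d < n) (hU : IsOpen U)
    (hBU : closedBall 0 1 ⊆ U) (hT : 1 ≤ T) (hg : Function.support g ⊆ ball 0 1)
    (hψ : Function.support ψ ⊆ ball 0 1) (hgn : ContDiff ℝ n g) (hΦ : ContDiffOn ℝ n Φ U)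
    (hψn : ContDiff ℝ n ψ) {G : ℝ} (hG : ∀ i ≤ n, ∀ x, ‖iteratedFDeriv ℝ i g x‖ ≤ G)
    (hinj : InjOn (gradient Φ) (ball 0 1)) (hL : 0 < LStar Φ (ball 0 1)) :
    |∫ u, g u| * (T ^ d * ‖oscInt (T ^ 2) Φ ψ‖) ≤
      2 * 2 ^ n * ((16 * Real.pi) ^ n * (n + 1) * (n ! : ℝ) ^ 2 * G * 2 ^ d *
        volume.real (closedBall (0 : Euc d) 1)) * (∫ w : Euc d, ((1 + ‖w‖) ^ n)⁻¹) *
        (1 / LStar Φ (ball 0 1)) * (1 + 2 * Pnorm n Φ (ball 0 1)) ^ n *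
        CnormNat n ψ (ball 0 1) := by
  set A := CnormNat n ψ (ball 0 1)
  set P := Pnorm n Φ (ball 0 1)
  set V := volume.real (closedBall (0 : Euc d) 1)
  set L := LStar Φ (ball 0 1)
  set W := ∫ w : Euc d, ((1 + ‖w‖) ^ n)⁻¹
  have hA0 : 0 ≤ A := CnormNat_nonneg _ _ _
  have hP0 : 0 ≤ P := Pnorm_nonneg _ _ _
  have hV0 : 0 ≤ V := measureReal_nonneg
  have hG0 : 0 ≤ G := (norm_nonneg _).trans (hG 0 (Nat.zero_le _) 0)
  have hT0 : 0 < T := by linarith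
  set h : Euc d → ℂ := fun x => Complex.exp (Complex.I * ((T ^ 2 : ℝ) : ℂ) * Φ x) * ψ x with hh
  have hhs : Function.support h ⊆ ball 0 1 := fun x hx => hψ fun h0 => hx (by simp [hh, h0])
  have hhc : Continuous h := continuous_iff_continuousAt.2 fun x => by
    by_cases hx : x ∈ U
    · have hΦx : ContinuousAt Φ x := hΦ.continuousOn.continuousAt (hU.mem_nhds hx)
      have hψx : ContinuousAt ψ x := hψn.continuous.continuousAt
      fun_prop
    · have hev : h =ᶠ[nhds x] fun _ => 0 :=
        notMem_tsupport_iff_eventuallyEq.1 fun hxs => hx (hBU (closure_minimal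
          (hhs.trans ball_subset_closedBall) isClosed_closedBall hxs))
      exact continuousAt_const.congr hev.symm
  set K := 2 * 2 ^ n * ((16 * Real.pi) ^ n * (n + 1) * (n ! : ℝ) ^ 2 * G * 2 ^ d * V * A *
    (1 + 2 * P) ^ n * (T ^ d)⁻¹) with hK
  have hK0 : 0 ≤ K := by have := Real.pi_pos; positivity
  obtain ⟨hint, hle⟩ := integrableOn_and_integral_abs_det_le (n := n) hdn hT0
    (fun x hx => (hΦ.contDiffAt (hU.mem_nhds (hBU (ball_subset_closedBall hx)))).of_le
      (by exact_mod_cast hn)) hinj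
  have hbound : ‖∫ y, ∫ x, h x * (g (T • y - (T - 1) • x) : ℂ)‖ ≤ K / L * ((T ^ d)⁻¹ * W) := by
    refine (norm_integral_le_of_norm_le
      (IntegrableOn.integrable_indicator (hint.const_mul (K / L)) measurableSet_ball)
      (ae_of_all _ fun y => ?_)).trans ?_
    · by_cases hy : y ∈ ball (0 : Euc d) 1
      · rw [indicator_of_mem hy]
        refine (norm_packet_le hn hU hBU hT hg hψ hgn hΦ hψn hG hy).trans ?_
        beta_reduce
        rw [← mul_assoc (K / L)]
        refine mul_le_mul_of_nonneg_right ?_ (inv_nonneg.2 (by positivity))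
        rw [div_mul_eq_mul_div, le_div_iff₀ hL]
        exact mul_le_mul_of_nonneg_left (LStar_le_abs_det hy) hK0
      · have hz : ∀ x, h x * (g (T • y - (T - 1) • x) : ℂ) = 0 := fun x => by
          by_contra hne
          have hx : x ∈ ball (0 : Euc d) 1 := hhs fun h0 => hne (by simp [h0])
          have hw : T • y - (T - 1) • x ∈ ball (0 : Euc d) 1 := hg fun h0 => hne (by simp [h0])
          exact hy (mem_ball_of_window hT hx hw).1
        rw [indicator_of_notMem hy]
        simp only [hz, integral_zero, norm_zero, le_refl]
    · rw [integral_indicator measurableSet_ball, integral_const_mul]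
      gcongr
  have hid := congrArg norm (integral_mul_integral_eq_integral_packets hT hg hgn.continuous hhs hhc)
  rw [norm_mul, norm_mul, norm_pow, Complex.norm_real, Complex.norm_real, Real.norm_eq_abs,
    Real.norm_of_nonneg hT0.le] at hid
  calc |∫ u, g u| * (T ^ d * ‖oscInt (T ^ 2) Φ ψ‖)
      = T ^ d * (T ^ d * ‖∫ y, ∫ x, h x * (g (T • y - (T - 1) • x) : ℂ)‖) := by
        rw [← hid]
        simp only [oscInt, hh]
        ring
    _ ≤ T ^ d * (T ^ d * (K / L * ((T ^ d)⁻¹ * W))) := by gcongr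
    _ = _ := by
      rw [hK]
      field_simp

lemma exists_forall_norm_iteratedFDeriv_le {n : ℕ} (hgn : ContDiff ℝ n g)
    (hg : HasCompactSupport g) : ∃ G, ∀ i ≤ n, ∀ x, ‖iteratedFDeriv ℝ i g x‖ ≤ G := by
  have hb : ∀ i, ∃ G, i ≤ n → ∀ x, ‖iteratedFDeriv ℝ i g x‖ ≤ G := fun i => by
    by_cases hi : i ≤ n
    · obtain ⟨G, hG⟩ := (hg.iteratedFDeriv i).exists_bound_of_continuous
        (hgn.continuous_iteratedFDeriv (by exact_mod_cast hi))
      exact ⟨G, fun _ => hG⟩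
    · exact ⟨0, fun h => absurd h hi⟩
  choose G hG using hb
  refine ⟨∑ i ∈ Finset.range (n + 1), |G i|, fun i hi x => (hG i hi x).trans ?_⟩
  exact (le_abs_self _).trans (Finset.single_le_sum (f := fun i => |G i|)
    (fun _ _ => abs_nonneg _) (Finset.mem_range.2 (Nat.lt_succ_of_le hi)))

/-- uniform stationary phase estimate with only `d+1` orders of
differentiability of the phase (wave packet proof of the Alazard–Burq–Zuily estimate). -/
theorem stmt7 (d : ℕ) (hd : 1 ≤ d) :
    ∃ C : ℝ, 0 < C ∧
      ∀ (lam : ℝ) (Φ : Euc d → ℝ) (ψ : Euc d → ℂ) (U : Set (Euc d)),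
        1 ≤ lam →
        IsOpen U → closedBall 0 1 ⊆ U →
        ContDiffOn ℝ (d + 1 : ℕ) Φ U →
        ContDiff ℝ (d + 1 : ℕ) ψ →
        Function.support ψ ⊆ ball 0 1 →
        Set.InjOn (gradient Φ) (ball 0 1) →
        0 < LStar Φ (ball 0 1) →
        lam ^ ((d : ℝ) / 2) * ‖oscInt lam Φ ψ‖ ≤
          C * (1 / LStar Φ (ball 0 1)) *
            (1 + Pnorm (d + 1) Φ (ball 0 1) ^ (2 * d + 1)) *
            CnormNat (d + 1) ψ (ball 0 1) := by
  let b : ContDiffBump (0 : Euc d) := ⟨1 / 2, 1, by norm_num, by norm_num⟩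
  have hbs : Function.support b ⊆ ball 0 1 := b.support_eq.subset
  have hbn : ContDiff ℝ (d + 1 : ℕ) b := b.contDiff
  have hbI : 0 < ∫ u, b u := b.integral_pos
  obtain ⟨G, hG⟩ := exists_forall_norm_iteratedFDeriv_le hbn b.hasCompactSupport
  have hG0 : 0 ≤ G := (norm_nonneg _).trans (hG 0 (Nat.zero_le _) 0)
  set M := 2 * 2 ^ (d + 1) * ((16 * Real.pi) ^ (d + 1) * ((d + 1 : ℕ) + 1) *
    ((d + 1).factorial : ℝ) ^ 2 * G * 2 ^ d * volume.real (closedBall (0 : Euc d) 1)) *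
    ∫ w : Euc d, ((1 + ‖w‖) ^ (d + 1))⁻¹ with hM
  have hM0 : 0 ≤ M := by
    have hW : 0 ≤ ∫ w : Euc d, ((1 + ‖w‖) ^ (d + 1))⁻¹ :=
      integral_nonneg fun w => by positivity
    have := Real.pi_pos
    positivity
  refine ⟨M * 3 ^ (d + 1) / (∫ u, b u) + 1, by positivity, ?_⟩
  intro lam Φ ψ U hlam hU hBU hΦ hψn hψ hinj hL
  have hT : 1 ≤ √lam := Real.one_le_sqrt.2 hlam
  have hA0 := CnormNat_nonneg (d + 1) ψ (ball 0 1)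
  have hP0 := Pnorm_nonneg (d + 1) Φ (ball 0 1)
  have hmain := integral_mul_norm_oscInt_le (by omega) (Nat.lt_succ_self d) hU hBU hT hbs hψ hbn
    hΦ hψn hG hinj hL
  rw [Real.sq_sqrt (by linarith), abs_of_pos hbI, ← hM, ← le_div_iff₀' hbI] at hmain
  rw [Real.rpow_div_two_eq_sqrt _ (by linarith), Real.rpow_natCast]
  refine hmain.trans ?_
  calc M * (1 / LStar Φ (ball 0 1)) * (1 + 2 * Pnorm (d + 1) Φ (ball 0 1)) ^ (d + 1) *
        CnormNat (d + 1) ψ (ball 0 1) / ∫ u, b u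
      ≤ M * (1 / LStar Φ (ball 0 1)) *
          (3 ^ (d + 1) * (1 + Pnorm (d + 1) Φ (ball 0 1) ^ (2 * d + 1))) *
          CnormNat (d + 1) ψ (ball 0 1) / ∫ u, b u := by
        gcongr
        exact one_add_two_mul_pow_le hP0 (by omega)
    _ = M * 3 ^ (d + 1) / (∫ u, b u) * (1 / LStar Φ (ball 0 1)) *
          (1 + Pnorm (d + 1) Φ (ball 0 1) ^ (2 * d + 1)) *
          CnormNat (d + 1) ψ (ball 0 1) := by ring
    _ ≤ _ := by
        gcongr
        linarith

end
end

section
/- Let d ≥ 1, n ∈ ℕ, and 0 < β < 1. Suppose f ∈ C^{n+β}(ℝ^d) (i.e. f is C^n with D^γ f Hölder continuous of order β for |γ| = n) and g ∈ C_c^{n+1+β} with supp g ⊂ B(0,1) ⊂ ℝ^d. Then for all p ≥ 0, λ > 1, and k ∈ ℝ^d \ {0}, |∫_{ℝ^d} f(λ^{-p}x) g(x) e^{-ik·x} dx| ≤ C · ‖f‖_{C^{n+β}} · ‖g‖_{C^{n+1+β}} · (λ^{-pβ}|k|^{-n-β} + |k|^{-n-1-β}), with C independent of p, λ, k, f, g.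 -/
open MeasureTheory Metric Set RealInnerProductSpace

noncomputable section

/-- The sequence `F 0, …, F N` consists of successive derivatives in the direction `v`, all of
which are continuous, bounded by `M` and `β`-Hölder with constant `M`. -/
structure DirectionalHolder {d : ℕ} (β : ℝ) (v : Euc d) (N : ℕ) (M : ℝ)
    (F : ℕ → Euc d → ℂ) : Prop where
  continuous : ∀ j ≤ N, Continuous (F j)
  hasLineDerivAt : ∀ j < N, ∀ x, HasLineDerivAt ℝ (F j) (F (j + 1) x) x v
  norm_le : ∀ j ≤ N, ∀ x, ‖F j x‖ ≤ M
  norm_sub_le : ∀ j ≤ N, ∀ x y, ‖F j x - F j y‖ ≤ M * ‖x - y‖ ^ β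

namespace DirectionalHolder

variable {d : ℕ} {β M : ℝ} {v : Euc d} {N : ℕ} {F : ℕ → Euc d → ℂ}

lemma nonneg (h : DirectionalHolder β v N M F) : 0 ≤ M :=
  (norm_nonneg _).trans (h.norm_le 0 (Nat.zero_le _) 0)

lemma mono (h : DirectionalHolder β v N M F) {N' : ℕ} (hN : N' ≤ N) :
    DirectionalHolder β v N' M F where
  continuous j hj := h.continuous j (hj.trans hN)
  hasLineDerivAt j hj := h.hasLineDerivAt j (hj.trans_le hN)
  norm_le j hj := h.norm_le j (hj.trans hN)
  norm_sub_le j hj := h.norm_sub_le j (hj.trans hN)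

lemma shift (h : DirectionalHolder β v (N + 1) M F) :
    DirectionalHolder β v N M (fun j ↦ F (j + 1)) where
  continuous j hj := h.continuous _ (by omega)
  hasLineDerivAt j hj := h.hasLineDerivAt _ (by omega)
  norm_le j hj := h.norm_le _ (by omega)
  norm_sub_le j hj := h.norm_sub_le _ (by omega)

lemma norm_second_difference_le (h : DirectionalHolder β v (N + 1) M F) (hv : ‖v‖ = 1)
    {r : ℝ} (hr : 0 < r) (x : Euc d) :
    ‖F 0 x - 2 * F 0 (x + r • v) + F 0 (x + (2 * r) • v)‖ ≤ M * r ^ (1 + β) := by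
  have hd : ∀ (z : Euc d) (t : ℝ),
      HasDerivAt (fun s : ℝ ↦ F 0 (z + (s * r) • v)) (r • F 1 (z + (t * r) • v)) t := by
    intro z t
    have h0 := h.hasLineDerivAt 0 (by omega) (z + (t * r) • v)
    rw [HasLineDerivAt] at h0
    have h1 : HasDerivAt (fun s : ℝ ↦ (s - t) * r) r t := by
      simpa using ((hasDerivAt_id t).sub_const t).mul_const r
    have h2 := HasDerivAt.scomp_of_eq t h0 h1 (by simp)
    refine h2.congr_of_eventuallyEq (Filter.Eventually.of_forall fun s ↦ ?_)
    simp only [Function.comp]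
    rw [add_assoc, ← add_smul]
    congr 3
    ring
  have hm := norm_image_sub_le_of_norm_deriv_le_segment_01'
    (f := fun s : ℝ ↦ F 0 (x + r • v + (s * r) • v) - F 0 (x + (s * r) • v))
    (f' := fun s ↦ r • F 1 (x + r • v + (s * r) • v) - r • F 1 (x + (s * r) • v))
    (C := M * r ^ (1 + β)) (fun s _ ↦ ((hd _ s).sub (hd _ s)).hasDerivWithinAt) (fun s _ ↦ by
      rw [← smul_sub, norm_smul, Real.norm_of_nonneg hr.le]
      have := h.norm_sub_le 1 (by omega) (x + r • v + (s * r) • v) (x + (s * r) • v)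
      rw [show x + r • v + (s * r) • v - (x + (s * r) • v) = r • v by abel, norm_smul, hv,
        Real.norm_of_nonneg hr.le, mul_one] at this
      rw [Real.rpow_add hr, Real.rpow_one]
      nlinarith)
  refine le_trans (le_of_eq ?_) hm
  congr 1
  simp only [one_mul, zero_mul, zero_smul, add_zero]
  rw [add_assoc x, ← add_smul, ← two_mul]
  ring

end DirectionalHolder

/-- The plane wave `x ↦ e^{-ik·x}`. -/
def planeWave {d : ℕ} (k x : Euc d) : ℂ := Complex.exp (-Complex.I * ((⟪k, x⟫ : ℝ) : ℂ))

variable {d : ℕ}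

lemma norm_planeWave (k x : Euc d) : ‖planeWave k x‖ = 1 := by
  rw [planeWave, show -Complex.I * ((⟪k, x⟫ : ℝ) : ℂ) = ((-⟪k, x⟫ : ℝ) : ℂ) * Complex.I by
    push_cast; ring]
  exact Complex.norm_exp_ofReal_mul_I _

lemma continuous_planeWave (k : Euc d) : Continuous (planeWave k) := by
  unfold planeWave
  fun_prop

lemma planeWave_add (k x y : Euc d) : planeWave k (x + y) = planeWave k x * planeWave k y := by
  simp only [planeWave, ← Complex.exp_add, inner_add_right]
  push_cast
  ring_nf

lemma planeWave_half_period {κ : ℝ} (hκ : 0 < κ) {v : Euc d} (hv : ‖v‖ = 1) :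
    planeWave (κ • v) ((Real.pi / κ) • v) = -1 := by
  have : ⟪κ • v, (Real.pi / κ) • v⟫ = Real.pi := by
    rw [real_inner_smul_left, real_inner_smul_right, real_inner_self_eq_norm_sq, hv]
    field_simp
  rw [planeWave, this, neg_mul, mul_comm, Complex.exp_neg, Complex.exp_pi_mul_I]
  norm_num

lemma hasLineDerivAt_planeWave (κ : ℝ) {v : Euc d} (hv : ‖v‖ = 1) (x : Euc d) :
    HasLineDerivAt ℝ (planeWave (κ • v)) (-Complex.I * κ * planeWave (κ • v) x) x v := by
  rw [HasLineDerivAt]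
  have h1 : HasDerivAt (fun t : ℝ ↦ -Complex.I * ((⟪κ • v, x⟫ + t * κ : ℝ) : ℂ))
      (-Complex.I * κ) 0 := by
    have := (((hasDerivAt_id (0 : ℝ)).mul_const κ).const_add ⟪κ • v, x⟫).ofReal_comp.const_mul
      (-Complex.I)
    simpa using this
  have h2 := h1.cexp
  have h3 : ∀ t : ℝ, ⟪κ • v, x + t • v⟫ = ⟪κ • v, x⟫ + t * κ := fun t ↦ by
    rw [inner_add_right, real_inner_smul_right, real_inner_smul_left v v,
      real_inner_self_eq_norm_sq, hv]
    ring
  have h4 : (fun t : ℝ ↦ planeWave (κ • v) (x + t • v)) =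
      fun t ↦ Complex.exp (-Complex.I * ((⟪κ • v, x⟫ + t * κ : ℝ) : ℂ)) :=
    funext fun t ↦ by rw [planeWave, h3]
  rw [h4]
  refine h2.congr_deriv ?_
  simp [planeWave, mul_comm]

lemma integral_mul_planeWave_by_parts {κ : ℝ} {v : Euc d} (hv : ‖v‖ = 1)
    {H H' : Euc d → ℂ} (hH : Integrable H) (hH' : Integrable H')
    (hd : ∀ x, HasLineDerivAt ℝ H (H' x) x v) :
    Complex.I * κ * ∫ x, H x * planeWave (κ • v) x = ∫ x, H' x * planeWave (κ • v) x := by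
  have hi : ∀ {g : Euc d → ℂ}, Integrable g →
      Integrable (fun x ↦ g x * planeWave (κ • v) x) := fun hg ↦
    hg.mul_bdd (c := 1) (continuous_planeWave _).aestronglyMeasurable
      (Filter.Eventually.of_forall fun x ↦ (norm_planeWave _ x).le)
  have := integral_bilinear_hasLineDerivAt_right_eq_neg_left_of_integrable
    (μ := (volume : Measure (Euc d))) (B := ContinuousLinearMap.mul ℝ ℂ)
    (f := H) (f' := H') (g := planeWave (κ • v))
    (g' := fun x ↦ -Complex.I * κ * planeWave (κ • v) x) (v := v)
    (hi hH') (by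
      simpa [mul_left_comm, mul_assoc] using ((hi hH).const_mul (-Complex.I * (κ : ℂ)))) (hi hH)
    (fun x _ ↦ hd x) (fun x _ ↦ hasLineDerivAt_planeWave κ hv x)
  simp only [ContinuousLinearMap.mul_apply'] at this
  rw [← neg_inj, ← this, ← integral_const_mul, ← integral_neg]
  congr 1
  ext x
  ring

lemma norm_integral_le_of_closedBall {H : Euc d → ℂ} {R c : ℝ}
    (h0 : ∀ x, R < ‖x‖ → H x = 0) (hc : ∀ x, ‖H x‖ ≤ c) :
    ‖∫ x, H x‖ ≤ c * volume.real (closedBall (0 : Euc d) R) := by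
  rw [← setIntegral_eq_integral_of_forall_compl_eq_zero (s := closedBall (0 : Euc d) R)]
  · exact norm_setIntegral_le_of_norm_le_const measure_closedBall_lt_top fun x _ ↦ hc x
  · intro x hx
    exact h0 x (by simpa using hx)

lemma integrable_of_closedBall {H : Euc d → ℂ} (hH : Continuous H)
    (h0 : ∀ x, 1 < ‖x‖ → H x = 0) : Integrable H :=
  hH.integrable_of_hasCompactSupport
    (HasCompactSupport.intro (isCompact_closedBall (0 : Euc d) 1) fun x hx ↦
      h0 x (by simpa using hx))

/-- Translating twice by a half period of the wave turns the integral into one of a second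
difference. -/
lemma four_mul_integral_mul_planeWave {κ : ℝ} (hκ : 0 < κ) {v : Euc d} (hv : ‖v‖ = 1)
    {H : Euc d → ℂ} (hH : Integrable H) :
    4 * ∫ x, H x * planeWave (κ • v) x =
      ∫ x, (H x - 2 * H (x + (Real.pi / κ) • v) + H (x + (2 * (Real.pi / κ)) • v)) *
        planeWave (κ • v) x := by
  set y := (Real.pi / κ) • v with hy
  set e := planeWave (κ • v) with he
  have hey : ∀ x, e (x + y) = -e x := fun x ↦ by
    rw [he, planeWave_add, planeWave_half_period hκ hv]; ring
  have h2y : ∀ x : Euc d, x + (2 * (Real.pi / κ)) • v = x + y + y := fun x ↦ by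
    rw [two_mul, add_smul, ← add_assoc]
  simp only [h2y]
  have hi : ∀ {g : Euc d → ℂ}, Integrable g → Integrable (fun x ↦ g x * e x) := fun hg ↦
    hg.mul_bdd (c := 1) (continuous_planeWave _).aestronglyMeasurable
      (Filter.Eventually.of_forall fun x ↦ (norm_planeWave _ x).le)
  have hs : ∀ g : Euc d → ℂ, ∫ x, g (x + y) * e x = -∫ x, g x * e x := fun g ↦ by
    rw [← integral_add_right_eq_self (fun x ↦ g x * e x) y, ← integral_neg]
    simp [hey]
  have hH1 : Integrable (fun x ↦ H (x + y)) := hH.comp_add_right y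
  have hH2 : Integrable (fun x ↦ H (x + y + y)) := hH1.comp_add_right y
  have e1 : (fun x ↦ (H x - 2 * H (x + y) + H (x + y + y)) * e x) =
      fun x ↦ (H x * e x - 2 * (H (x + y) * e x)) + H (x + y + y) * e x := by
    ext x; ring
  have hi1 : Integrable (fun x ↦ H x * e x - 2 * (H (x + y) * e x)) :=
    (hi hH).sub ((hi hH1).const_mul 2)
  rw [e1, integral_add hi1 (hi hH2), integral_sub (hi hH) ((hi hH1).const_mul 2), integral_const_mul,
    hs (fun x ↦ H (x + y)), hs H]
  ring

lemma norm_integral_holder_le {β : ℝ} (hβ0 : 0 < β) (hβ1 : β < 1) {κ : ℝ} (hκ : 0 < κ)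
    {v : Euc d} (hv : ‖v‖ = 1) {μ : ℝ} (hμ : 0 < μ) {A B : ℝ} {F G : ℕ → Euc d → ℂ}
    (hF : DirectionalHolder β v 0 A F) (hG : DirectionalHolder β v 1 B G)
    (hG0 : ∀ x, 1 < ‖x‖ → G 0 x = 0) :
    ‖∫ x, F 0 (μ • x) * G 0 x * planeWave (κ • v) x‖ ≤
      16 * volume.real (closedBall (0 : Euc d) 9) * (A * B) *
        (μ ^ β * κ ^ (-β) + κ ^ (-1 - β)) := by
  set V := volume.real (closedBall (0 : Euc d) 9)
  have hV : 0 ≤ V := measureReal_nonneg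
  have hA := hF.nonneg
  have hB := hG.nonneg
  have hAB : 0 ≤ A * B := mul_nonneg hA hB
  rcases lt_or_ge κ 1 with h1 | h1
  · have := norm_integral_le_of_closedBall (R := 9) (c := A * B)
      (H := fun x ↦ F 0 (μ • x) * G 0 x * planeWave (κ • v) x)
      (fun x hx ↦ by rw [hG0 x (by linarith)]; ring)
      (fun x ↦ by
        rw [norm_mul, norm_planeWave, mul_one, norm_mul]
        exact mul_le_mul (hF.norm_le 0 le_rfl _) (hG.norm_le 0 (by omega) _) (norm_nonneg _) hA)
    refine this.trans ?_
    have h2 : 1 ≤ κ ^ (-1 - β) :=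
      Real.one_le_rpow_of_pos_of_le_one_of_nonpos hκ h1.le (by linarith)
    have h3 : 0 ≤ μ ^ β * κ ^ (-β) := by positivity
    have h4 : 0 ≤ A * B * V := by positivity
    nlinarith
  · set r := Real.pi / κ with hr
    have hr0 : 0 < r := div_pos Real.pi_pos hκ
    have hr4 : r ≤ 4 := by
      rw [hr, div_le_iff₀ hκ]
      nlinarith [Real.pi_lt_four]
    have hint : Integrable (fun x ↦ F 0 (μ • x) * G 0 x) :=
      integrable_of_closedBall
        (((hF.continuous 0 le_rfl).comp (continuous_const_smul μ)).mul (hG.continuous 0 (by omega)))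
        (fun x hx ↦ by rw [hG0 x hx, mul_zero])
    have h4 := four_mul_integral_mul_planeWave hκ hv hint
    have hnv : ∀ t : ℝ, 0 ≤ t → ‖t • v‖ = t := fun t ht ↦ by
      rw [norm_smul, hv, Real.norm_of_nonneg ht, mul_one]
    have hFd : ∀ x y : Euc d, ‖y - x‖ = r → ‖F 0 (μ • x) - F 0 (μ • y)‖ ≤ A * (μ ^ β * r ^ β) := by
      intro x y hxy
      refine (hF.norm_sub_le 0 le_rfl _ _).trans_eq ?_
      rw [← smul_sub, norm_smul, norm_sub_rev, hxy, Real.norm_of_nonneg hμ.le,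
        Real.mul_rpow hμ.le hr0.le]
    have hb := norm_integral_le_of_closedBall (R := 9)
      (c := 2 * (A * B) * (μ ^ β * r ^ β) + A * B * r ^ (1 + β))
      (H := fun x ↦ (F 0 (μ • x) * G 0 x
        - 2 * (F 0 (μ • (x + r • v)) * G 0 (x + r • v))
        + F 0 (μ • (x + (2 * r) • v)) * G 0 (x + (2 * r) • v)) * planeWave (κ • v) x)
      (fun x hx ↦ by
        have key : ∀ t : ℝ, 0 ≤ t → t ≤ 8 → G 0 (x + t • v) = 0 := fun t ht ht8 ↦ by
          refine hG0 _ ?_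
          have := norm_sub_le (x + t • v) (t • v)
          rw [add_sub_cancel_right, hnv t ht] at this
          linarith
        rw [hG0 x (by linarith), key r hr0.le (by linarith), key (2 * r) (by linarith)
          (by linarith)]
        ring)
      (fun x ↦ by
        rw [norm_mul, norm_planeWave, mul_one]
        have e : F 0 (μ • x) * G 0 x - 2 * (F 0 (μ • (x + r • v)) * G 0 (x + r • v))
            + F 0 (μ • (x + (2 * r) • v)) * G 0 (x + (2 * r) • v) =
            F 0 (μ • (x + r • v)) * (G 0 x - 2 * G 0 (x + r • v) + G 0 (x + (2 * r) • v))
            + (F 0 (μ • x) - F 0 (μ • (x + r • v))) * G 0 x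
            + (F 0 (μ • (x + (2 * r) • v)) - F 0 (μ • (x + r • v))) * G 0 (x + (2 * r) • v) := by
          ring
        rw [e]
        refine (norm_add₃_le).trans ?_
        simp only [norm_mul]
        have b1 := mul_le_mul (hF.norm_le 0 le_rfl (μ • (x + r • v)))
          (hG.norm_second_difference_le hv hr0 x) (norm_nonneg _) hA
        have b2 := mul_le_mul (hFd x (x + r • v) (by rw [add_sub_cancel_left, hnv r hr0.le]))
          (hG.norm_le 0 (by omega) x) (norm_nonneg _) (by positivity)
        have b3 := mul_le_mul (hFd (x + (2 * r) • v) (x + r • v) (by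
            rw [add_sub_add_left_eq_sub, ← sub_smul, norm_smul, hv, mul_one,
              show r - 2 * r = -r by ring, norm_neg, Real.norm_of_nonneg hr0.le]))
          (hG.norm_le 0 (by omega) (x + (2 * r) • v)) (norm_nonneg _) (by positivity)
        nlinarith)
    rw [← h4, norm_mul, Complex.norm_ofNat] at hb
    have p1 : r ^ β ≤ 16 * κ ^ (-β) := by
      rw [hr, Real.div_rpow Real.pi_pos.le hκ.le, Real.rpow_neg hκ.le, div_eq_mul_inv]
      gcongr
      calc Real.pi ^ β ≤ Real.pi ^ (2 : ℝ) :=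
            Real.rpow_le_rpow_of_exponent_le (by linarith [Real.pi_gt_three]) (by linarith)
        _ ≤ 16 := by rw [Real.rpow_two]; nlinarith [Real.pi_lt_four, Real.pi_pos]
    have p2 : r ^ (1 + β) ≤ 16 * κ ^ (-1 - β) := by
      rw [hr, Real.div_rpow Real.pi_pos.le hκ.le, show -1 - β = -(1 + β) by ring,
        Real.rpow_neg hκ.le, div_eq_mul_inv]
      gcongr
      calc Real.pi ^ (1 + β) ≤ Real.pi ^ (2 : ℝ) :=
            Real.rpow_le_rpow_of_exponent_le (by linarith [Real.pi_gt_three]) (by linarith)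
        _ ≤ 16 := by rw [Real.rpow_two]; nlinarith [Real.pi_lt_four, Real.pi_pos]
    have q : 2 * (A * B) * (μ ^ β * r ^ β) + A * B * r ^ (1 + β) ≤
        2 * (A * B) * (μ ^ β * (16 * κ ^ (-β))) + 2 * (A * B * (16 * κ ^ (-1 - β))) := by
      have : 0 ≤ A * B * (16 * κ ^ (-1 - β)) := by positivity
      have : A * B * r ^ (1 + β) ≤ A * B * (16 * κ ^ (-1 - β)) := by gcongr
      have : 2 * (A * B) * (μ ^ β * r ^ β) ≤ 2 * (A * B) * (μ ^ β * (16 * κ ^ (-β))) := by gcongr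
      linarith
    have q2 := hb.trans (mul_le_mul_of_nonneg_right q hV)
    have : 0 ≤ V * (A * B) * (μ ^ β * κ ^ (-β) + κ ^ (-1 - β)) := by positivity
    linarith

lemma norm_integral_directionalHolder_le {β : ℝ} (hβ0 : 0 < β) (hβ1 : β < 1) {κ : ℝ} (hκ : 0 < κ)
    {v : Euc d} (hv : ‖v‖ = 1) {μ : ℝ} (hμ : 0 < μ) (hμ1 : μ ≤ 1) {A B : ℝ} (n : ℕ) :
    ∀ {F G : ℕ → Euc d → ℂ}, DirectionalHolder β v n A F → DirectionalHolder β v (n + 1) B G →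
      (∀ j ≤ n, ∀ x, 1 < ‖x‖ → G j x = 0) →
      ‖∫ x, F 0 (μ • x) * G 0 x * planeWave (κ • v) x‖ ≤
        2 ^ n * (16 * volume.real (closedBall (0 : Euc d) 9)) * (A * B) *
          (μ ^ β * κ ^ (-(n : ℝ) - β) + κ ^ (-(n : ℝ) - 1 - β)) := by
  induction n with
  | zero =>
    intro F G hF hG hG0
    simpa using norm_integral_holder_le hβ0 hβ1 hκ hv hμ hF hG (hG0 0 le_rfl)
  | succ n ih =>
    intro F G hF hG hG0
    have i1 := ih hF.shift (hG.mono (by omega)) (fun j hj ↦ hG0 j (by omega))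
    have i2 := ih (hF.mono (by omega)) hG.shift (fun j hj ↦ hG0 (j + 1) (by omega))
    simp only [zero_add] at i1 i2
    have hc : ∀ i ≤ n + 1, ∀ j ≤ n + 1, Integrable (fun x ↦ F i (μ • x) * G j x) :=
      fun i hi j hj ↦ integrable_of_closedBall
        (((hF.continuous i hi).comp (continuous_const_smul μ)).mul (hG.continuous j (by omega)))
        (fun x hx ↦ by rw [hG0 j hj x hx, mul_zero])
    have hd : ∀ x, HasLineDerivAt ℝ (fun x ↦ F 0 (μ • x) * G 0 x)
        (μ * (F 1 (μ • x) * G 0 x) + F 0 (μ • x) * G 1 x) x v := by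
      intro x
      have dF : HasDerivAt (fun t : ℝ ↦ F 0 (μ • (x + t • v))) (μ • F 1 (μ • x)) 0 := by
        have := (hF.hasLineDerivAt 0 (by omega) (μ • x)).smul μ
        simpa [HasLineDerivAt, smul_add, smul_comm μ] using this
      have dG := hG.hasLineDerivAt 0 (by omega) x
      rw [HasLineDerivAt] at dG ⊢
      refine (dF.mul dG).congr_deriv ?_
      simp [mul_assoc]
    have hb := integral_mul_planeWave_by_parts (κ := κ) hv (hc 0 (by omega) 0 (by omega))
      (H' := fun x ↦ μ * (F 1 (μ • x) * G 0 x) + F 0 (μ • x) * G 1 x)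
      (((hc 1 (by omega) 0 (by omega)).const_mul (μ : ℂ)).add (hc 0 (by omega) 1 (by omega))) hd
    have hi : ∀ {g : Euc d → ℂ}, Integrable g →
        Integrable (fun x ↦ g x * planeWave (κ • v) x) := fun hg ↦
      hg.mul_bdd (c := 1) (continuous_planeWave _).aestronglyMeasurable
        (Filter.Eventually.of_forall fun x ↦ (norm_planeWave _ x).le)
    have es : ∀ x, (μ * (F 1 (μ • x) * G 0 x) + F 0 (μ • x) * G 1 x) * planeWave (κ • v) x =
        μ * (F 1 (μ • x) * G 0 x * planeWave (κ • v) x) +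
          F 0 (μ • x) * G 1 x * planeWave (κ • v) x := fun x ↦ by ring
    simp only [es] at hb
    rw [integral_add ((hi (hc 1 (by omega) 0 (by omega))).const_mul _)
      (hi (hc 0 (by omega) 1 (by omega))), integral_const_mul] at hb
    have hn := congrArg norm hb
    rw [norm_mul, norm_mul, Complex.norm_I, one_mul, Complex.norm_real,
      Real.norm_of_nonneg hκ.le] at hn
    have hle := norm_add_le (μ * ∫ x, F 1 (μ • x) * G 0 x * planeWave (κ • v) x)
      (∫ x, F 0 (μ • x) * G 1 x * planeWave (κ • v) x)
    rw [← hn, norm_mul, Complex.norm_real, Real.norm_of_nonneg hμ.le] at hle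
    have hle2 := hle.trans (add_le_add
      ((mul_le_of_le_one_left (norm_nonneg _) hμ1).trans i1) i2)
    refine le_of_mul_le_mul_left (hle2.trans_eq ?_) hκ
    have e1 : κ ^ (-(n : ℝ) - β) = κ * κ ^ (-((n + 1 : ℕ) : ℝ) - β) := by
      nth_rewrite 2 [← Real.rpow_one κ]
      rw [← Real.rpow_add hκ]
      congr 1
      push_cast
      ring
    have e2 : κ ^ (-(n : ℝ) - 1 - β) = κ * κ ^ (-((n + 1 : ℕ) : ℝ) - 1 - β) := by
      nth_rewrite 2 [← Real.rpow_one κ]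
      rw [← Real.rpow_add hκ]
      congr 1
      push_cast
      ring
    rw [e1, e2, pow_succ]
    ring

/-- A bounded Lipschitz function is Hölder. -/
lemma norm_sub_le_rpow_of_lipschitz {E W : Type*} [NormedAddCommGroup E] [NormedAddCommGroup W]
    {h : E → W} {M β : ℝ} (hβ0 : 0 < β) (hβ1 : β < 1) (hb : ∀ x, ‖h x‖ ≤ M)
    (hl : ∀ x y, ‖h x - h y‖ ≤ M * ‖x - y‖) (x y : E) :
    ‖h x - h y‖ ≤ 2 * M * ‖x - y‖ ^ β := by
  have hM : 0 ≤ M := (norm_nonneg _).trans (hb x)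
  rcases le_total ‖x - y‖ 1 with h1 | h1
  · have h2 : ‖x - y‖ ≤ ‖x - y‖ ^ β := Real.self_le_rpow_of_le_one (norm_nonneg _) h1 hβ1.le
    nlinarith [hl x y, norm_nonneg (x - y), mul_le_mul_of_nonneg_left h2 hM,
      mul_nonneg hM (norm_nonneg (x - y))]
  · have h2 : 1 ≤ ‖x - y‖ ^ β := Real.one_le_rpow h1 hβ0.le
    nlinarith [norm_sub_le (h x) (h y), hb x, hb y]

lemma ContDiff.directionalHolder {β : ℝ} (hβ0 : 0 < β) (hβ1 : β < 1) {v : Euc d} (hv : ‖v‖ = 1)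
    {f : Euc d → ℂ} {M : ℝ} {N : ℕ} (hf : ContDiff ℝ N f)
    (hb : ∀ i ≤ N, ∀ x, ‖iteratedFDeriv ℝ i f x‖ ≤ M)
    (hh : ∀ x y, ‖iteratedFDeriv ℝ N f x - iteratedFDeriv ℝ N f y‖ ≤ M * ‖x - y‖ ^ β) :
    DirectionalHolder β v N (2 * M) (fun j x ↦ iteratedFDeriv ℝ j f x (fun _ ↦ v)) := by
  have hM : 0 ≤ M := (norm_nonneg _).trans (hb 0 (Nat.zero_le _) 0)
  have hop : ∀ {j : ℕ} (L : ContinuousMultilinearMap ℝ (fun _ : Fin j ↦ Euc d) ℂ),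
      ‖L (fun _ ↦ v)‖ ≤ ‖L‖ := fun L ↦ by
    simpa [hv] using L.le_opNorm (fun _ ↦ v)
  have hdiff : ∀ j < N, Differentiable ℝ (iteratedFDeriv ℝ j f) := fun j hj ↦
    hf.differentiable_iteratedFDeriv (by exact_mod_cast hj)
  refine ⟨fun j hj ↦ ?_, fun j hj x ↦ ?_, fun j hj x ↦ ?_, fun j hj x y ↦ ?_⟩
  · exact (ContinuousMultilinearMap.apply ℝ (fun _ : Fin j ↦ Euc d) ℂ (fun _ ↦ v)).continuous.comp
      (hf.continuous_iteratedFDeriv (by exact_mod_cast hj))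
  · have h1 := ((ContinuousMultilinearMap.apply ℝ (fun _ : Fin j ↦ Euc d) ℂ
      (fun _ ↦ v)).hasFDerivAt.comp x (hdiff j hj x).hasFDerivAt).hasLineDerivAt v
    exact h1
  · linarith [hop (iteratedFDeriv ℝ j f x), hb j hj x]
  · refine le_trans (hop (iteratedFDeriv ℝ j f x - iteratedFDeriv ℝ j f y)) ?_
    rcases hj.eq_or_lt with rfl | hj
    · have : 0 ≤ M * ‖x - y‖ ^ β := by positivity
      linarith [hh x y]
    · refine norm_sub_le_rpow_of_lipschitz hβ0 hβ1 (hb j hj.le) (fun x y ↦ ?_) x y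
      exact convex_univ.norm_image_sub_le_of_norm_fderiv_le (𝕜 := ℝ)
        (fun z _ ↦ hdiff j hj z)
        (fun z _ ↦ by rw [norm_fderiv_iteratedFDeriv]; exact hb (j + 1) hj z)
        (mem_univ y) (mem_univ x)

/-- Lemma `HOLDER`: if `f ∈ C^{n+β}` with `‖f‖_{C^{n+β}} ≤ Mf` and
`g ∈ C_c^{n+1+β}(B(0,1))` with `‖g‖_{C^{n+1+β}} ≤ Mg`, then
`|∫ f(λ^{-p}x) g(x) e^{-ik·x} dx| ≤ C Mf Mg (λ^{-pβ}|k|^{-n-β} + |k|^{-n-1-β})`,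
with `C` independent of `p ≥ 0`, `λ > 1`, `k ≠ 0`, `f` and `g`. -/
theorem stmt10 (d : ℕ) (hd : 1 ≤ d) (n : ℕ) (β : ℝ) (hβ0 : 0 < β) (hβ1 : β < 1) :
    ∃ C : ℝ, 0 < C ∧
      ∀ (f g : Euc d → ℂ) (Mf Mg : ℝ),
        ContDiff ℝ (n : ℕ) f →
        (∀ i : ℕ, i ≤ n → ∀ x, ‖iteratedFDeriv ℝ i f x‖ ≤ Mf) →
        (∀ x y : Euc d,
          ‖iteratedFDeriv ℝ n f x - iteratedFDeriv ℝ n f y‖ ≤ Mf * ‖x - y‖ ^ β) →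
        ContDiff ℝ (n + 1 : ℕ) g →
        Function.support g ⊆ ball 0 1 →
        (∀ i : ℕ, i ≤ n + 1 → ∀ x, ‖iteratedFDeriv ℝ i g x‖ ≤ Mg) →
        (∀ x y : Euc d,
          ‖iteratedFDeriv ℝ (n + 1) g x - iteratedFDeriv ℝ (n + 1) g y‖ ≤
            Mg * ‖x - y‖ ^ β) →
        ∀ (p lam : ℝ) (k : Euc d), 0 ≤ p → 1 < lam → k ≠ 0 →
          ‖∫ x : Euc d,
              f (lam ^ (-p) • x) * g x * Complex.exp (-Complex.I * ((⟪k, x⟫ : ℝ) : ℂ))‖ ≤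
            C * Mf * Mg *
              (lam ^ (-p * β) * ‖k‖ ^ (-(n : ℝ) - β) + ‖k‖ ^ (-(n : ℝ) - 1 - β)) := by
  set V := volume.real (closedBall (0 : Euc d) 9) with hVdef
  have hV : 0 < V := by
    rw [hVdef, measureReal_def]
    exact ENNReal.toReal_pos (measure_closedBall_pos _ _ (by norm_num)).ne'
      measure_closedBall_lt_top.ne
  refine ⟨2 ^ n * (16 * V) * 4, by positivity, ?_⟩
  intro f g Mf Mg hf hfb hfh hg hgs hgb hgh p lam k hp hlam hk
  have hκ : 0 < ‖k‖ := norm_pos_iff.2 hk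
  have hlam0 : 0 < lam := by linarith
  have hv : ‖‖k‖⁻¹ • k‖ = 1 := by
    rw [norm_smul, norm_inv, norm_norm, inv_mul_cancel₀ hκ.ne']
  have hkv : ‖k‖ • ‖k‖⁻¹ • k = k := smul_inv_smul₀ hκ.ne' k
  have hsupp : ∀ j ≤ n, ∀ x, 1 < ‖x‖ →
      iteratedFDeriv ℝ j g x (fun _ ↦ ‖k‖⁻¹ • k) = 0 := by
    intro j _ x hx
    have hx' : x ∉ tsupport g := fun h ↦ by
      have := closure_minimal (hgs.trans ball_subset_closedBall) isClosed_closedBall h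
      rw [mem_closedBall_zero_iff] at this
      linarith
    have : iteratedFDeriv ℝ j g x = 0 := by
      by_contra h0
      exact hx' (support_iteratedFDeriv_subset (𝕜 := ℝ) j h0)
    rw [this]
    rfl
  have key := norm_integral_directionalHolder_le hβ0 hβ1 hκ hv
    (Real.rpow_pos_of_pos hlam0 (-p)) (Real.rpow_le_one_of_one_le_of_nonpos hlam.le (by linarith)) n
    (hf.directionalHolder hβ0 hβ1 hv hfb hfh) (hg.directionalHolder hβ0 hβ1 hv hgb hgh) hsupp
  simp only [iteratedFDeriv_zero_apply, hkv, ← Real.rpow_mul hlam0.le] at key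
  refine key.trans_eq ?_
  ring

end
end

section
/- Let d ≥ 1, λ ≥ 1, and let Φ be a real-valued C³ function on a neighborhood of B̄(0,1) ⊂ ℝ^d satisfying |∇Φ(x) − ∇Φ(y)| ≥ μ|x − y| for all x, y ∈ B̄(0,1) for some μ > 0 (so that HΦ(ν) is nonsingular for each ν ∈ B̄(0,1)). For ν ∈ B̄(0,1) let T_ν := |HΦ(ν)|^{-1/2} and B_ν := ν + λ^{-1/2}T_ν(B(0,1)). Then there exists a finite collection 𝓘_λ of points of B̄(0,1) such that B̄(0,1) ⊆ ∪_{ν ∈ 𝓘_λ} B_ν, and for any distinct ν, σ ∈ 𝓘_λ, either ν ∉ σ + λ^{-1/2}T_σ(B(0,1)) or σ ∉ ν + λ^{-1/2}T_ν(B(0,1)). -/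
open MeasureTheory Metric Set

noncomputable section

/-- Apply a matrix to a Euclidean vector. -/
noncomputable def mulVecE {d : ℕ} (M : Matrix (Fin d) (Fin d) ℝ) (x : Euc d) : Euc d :=
  (EuclideanSpace.equiv (Fin d) ℝ).symm (M.mulVec (EuclideanSpace.equiv (Fin d) ℝ x))

/-- `T = |HΦ(ν)|^{-1/2}`, characterized as the unique symmetric positive definite matrix
with `HΦ(ν)² ⬝ T⁴ = 1` (positive definiteness includes symmetry). -/
def IsAbsInvSqrtHess {d : ℕ} (Φ : Euc d → ℝ) (ν : Euc d)
    (T : Matrix (Fin d) (Fin d) ℝ) : Prop :=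
  T.PosDef ∧ (Hess Φ ν * Hess Φ ν) * (T * T * T * T) = 1

/-- The ellipsoid `ν + λ^{-1/2} T(B(0,r))`. -/
noncomputable def packet {d : ℕ} (lam : ℝ) (T : Matrix (Fin d) (Fin d) ℝ) (ν : Euc d)
    (r : ℝ) : Set (Euc d) :=
  (fun y => ν + (Real.sqrt lam)⁻¹ • mulVecE T y) '' ball 0 r

open scoped Matrix.Norms.L2Operator in
lemma norm_inv_pow_four_of_isAbsInvSqrtHess {d : ℕ} {Φ : Euc d → ℝ} {ν : Euc d}
    {T : Matrix (Fin d) (Fin d) ℝ} (h : IsAbsInvSqrtHess Φ ν T) :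
    ‖T⁻¹‖ ^ 4 = ‖Hess Φ ν * Hess Φ ν‖ := by
  obtain ⟨hpos, heq⟩ := h
  have hTu : IsUnit T.det := hpos.det_pos.ne'.isUnit
  have hinv : Hess Φ ν * Hess Φ ν = T⁻¹ * T⁻¹ * (T⁻¹ * T⁻¹) := by
    rw [← Matrix.inv_eq_left_inv heq]
    simp only [Matrix.mul_inv_rev, Matrix.mul_assoc]
  have hsa : star T⁻¹ = T⁻¹ := hpos.isHermitian.inv
  have hsa2 : star (T⁻¹ * T⁻¹) = T⁻¹ * T⁻¹ := by rw [star_mul, hsa]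
  have h1 : ‖T⁻¹ * T⁻¹‖ = ‖T⁻¹‖ * ‖T⁻¹‖ := by
    have := CStarRing.norm_star_mul_self (x := T⁻¹)
    rwa [hsa] at this
  have h2 := CStarRing.norm_star_mul_self (x := T⁻¹ * T⁻¹)
  rw [hsa2] at h2
  rw [hinv, h2, h1]
  ring

lemma continuousOn_hess {d : ℕ} {Φ : Euc d → ℝ} {U : Set (Euc d)} (hUo : IsOpen U)
    (hΦ : ContDiffOn ℝ 2 Φ U) : ContinuousOn (Hess Φ) U := by
  have h : ContinuousOn (iteratedFDeriv ℝ 2 Φ) U :=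
    (hΦ.continuousOn_iteratedFDerivWithin le_rfl hUo.uniqueDiffOn).congr
      fun x hx => (iteratedFDerivWithin_of_isOpen 2 hUo hx).symm
  refine continuousOn_pi.2 fun i => continuousOn_pi.2 fun j => ?_
  exact (ContinuousMultilinearMap.apply ℝ (fun _ : Fin 2 => Euc d) ℝ
    ![EuclideanSpace.single i (1 : ℝ), EuclideanSpace.single j (1 : ℝ)]).continuous.comp_continuousOn h

open scoped Matrix.Norms.L2Operator in
lemma ball_subset_packet {d : ℕ} {lam C r : ℝ} {T : Matrix (Fin d) (Fin d) ℝ} {ν : Euc d}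
    (hlam : 0 < lam) (hT : IsUnit T.det) (hC : ‖T⁻¹‖ ≤ C) (hr : √lam * C * r ≤ 1) (hC0 : 0 < C) :
    ball ν r ⊆ packet lam T ν 1 := by
  intro x hx
  have hs : 0 < √lam := Real.sqrt_pos.2 hlam
  refine ⟨√lam • mulVecE T⁻¹ (x - ν), ?_, ?_⟩
  · rw [mem_ball_zero_iff, norm_smul, Real.norm_of_nonneg hs.le]
    rw [mem_ball_iff_norm] at hx
    have h1 : ‖mulVecE T⁻¹ (x - ν)‖ ≤ ‖T⁻¹‖ * ‖x - ν‖ := Matrix.l2_opNorm_mulVec T⁻¹ (x - ν)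
    calc √lam * ‖mulVecE T⁻¹ (x - ν)‖ ≤ √lam * (C * ‖x - ν‖) := by
          gcongr
          exact h1.trans (by gcongr)
      _ < √lam * (C * r) := by gcongr
      _ ≤ 1 := by linarith
  · have h : mulVecE T (√lam • mulVecE T⁻¹ (x - ν)) = √lam • (x - ν) := by
      change WithLp.toLp 2 (T.mulVec (√lam • T⁻¹.mulVec (x - ν).ofLp)) = _
      rw [Matrix.mulVec_smul, Matrix.mulVec_mulVec, Matrix.mul_nonsing_inv T hT, Matrix.one_mulVec]
      rfl
    simp only [h, smul_smul, inv_mul_cancel₀ hs.ne', one_smul, add_sub_cancel]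

/-- A family of neighbourhoods `B x` of the points of a totally bounded set `K`, of size bounded
below, has a finite subfamily covering `K` no two of whose centres lie in each other's set. -/
lemma TotallyBounded.exists_finset_cover_separated {X : Type*} [PseudoMetricSpace X] {K : Set X}
    (hK : TotallyBounded K) (B : X → Set X) {r : ℝ} (hr : 0 < r)
    (hB : ∀ x ∈ K, ball x r ⊆ B x) :
    ∃ I : Finset X, (I : Set X) ⊆ K ∧ K ⊆ ⋃ x ∈ I, B x ∧
      ∀ x ∈ I, ∀ y ∈ I, x ≠ y → x ∉ B y ∨ y ∉ B x := by
  classical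
  obtain ⟨t, ht, hcov⟩ := Metric.totallyBounded_iff.1 hK (r / 2) (half_pos hr)
  let good : Finset X → Prop := fun I =>
    (I : Set X) ⊆ K ∧ ∀ x ∈ I, ∀ y ∈ I, x ≠ y → x ∉ B y ∨ y ∉ B x
  have hcard : ∀ I, good I → I.card ≤ ht.toFinset.card := by
    rintro I ⟨hIK, hI⟩
    have hex : ∀ x ∈ K, ∃ c ∈ t, dist x c < r / 2 := fun x hx => by
      simpa using hcov hx
    choose! f hft hf using hex
    refine Finset.card_le_card_of_injOn f (fun x hx => by simpa using hft x (hIK hx)) ?_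
    intro x hx y hy hxy
    by_contra hne
    have hd : dist x y < r := by
      have h1 := hf x (hIK hx)
      have h2 := hf y (hIK hy)
      rw [← hxy] at h2
      linarith [dist_triangle_right x y (f x)]
    rcases hI x hx y hy hne with h | h
    · exact h (hB y (hIK hy) hd)
    · exact h (hB x (hIK hx) (by rwa [mem_ball, dist_comm]))
  have hmax : ∃ I, good I ∧ ∀ J, good J → J.card ≤ I.card := by
    have hne : ∃ n, ∃ I, good I ∧ I.card = n := ⟨0, ∅, by simp [good], rfl⟩
    have hbdd : ∀ n, (∃ I, good I ∧ I.card = n) → n ≤ ht.toFinset.card := by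
      rintro n ⟨I, hI, rfl⟩
      exact hcard I hI
    obtain ⟨I, hI, hIc⟩ := Nat.sSup_mem (s := {n | ∃ I, good I ∧ I.card = n}) hne ⟨_, hbdd⟩
    exact ⟨I, hI, fun J hJ => hIc ▸ le_csSup ⟨_, hbdd⟩ ⟨J, hJ, rfl⟩⟩
  obtain ⟨I, ⟨hIK, hI⟩, hImax⟩ := hmax
  refine ⟨I, hIK, ?_, hI⟩
  intro y hy
  by_contra hyI
  simp only [mem_iUnion, not_exists] at hyI
  have hynot : y ∉ I := fun h => hyI y h (hB y hy (mem_ball_self hr))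
  have hgood : good (insert y I) := by
    refine ⟨by simpa [insert_subset_iff] using ⟨hy, hIK⟩, ?_⟩
    intro a ha b hb hab
    rcases Finset.mem_insert.1 ha with rfl | haI <;> rcases Finset.mem_insert.1 hb with rfl | hbI
    · exact absurd rfl hab
    · exact Or.inl (hyI b hbI)
    · exact Or.inr (hyI a haI)
    · exact hI a haI b hbI hab
  have := hImax _ hgood
  rw [Finset.card_insert_of_notMem hynot] at this
  omega

open scoped Matrix.Norms.L2Operator in
lemma exists_norm_inv_le_of_isAbsInvSqrtHess {d : ℕ} {Φ : Euc d → ℝ} {K U : Set (Euc d)}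
    {T : Euc d → Matrix (Fin d) (Fin d) ℝ} (hK : IsCompact K) (hUo : IsOpen U) (hU : K ⊆ U)
    (hΦ : ContDiffOn ℝ 2 Φ U) (hT : ∀ ν ∈ K, IsAbsInvSqrtHess Φ ν (T ν)) :
    ∃ C, 0 < C ∧ ∀ ν ∈ K, ‖(T ν)⁻¹‖ ≤ C := by
  have hcont : ContinuousOn (fun ν => Hess Φ ν * Hess Φ ν) K :=
    ((continuousOn_hess hUo hΦ).mul (continuousOn_hess hUo hΦ)).mono hU
  obtain ⟨M, hM⟩ := hK.exists_bound_of_continuousOn hcont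
  refine ⟨max M 1, by positivity, fun ν hν => ?_⟩
  refine le_of_pow_le_pow_left₀ four_ne_zero (by positivity) ?_
  rw [norm_inv_pow_four_of_isAbsInvSqrtHess (hT ν hν)]
  exact (hM ν hν).trans ((le_max_left M 1).trans (le_self_pow₀ (le_max_right M 1) four_ne_zero))

/-- Lemma `collection`: existence of a finite, well-separated collection
`𝓘_λ ⊆ B̄(0,1)` whose ellipsoids `B_ν = ν + λ^{-1/2}T_ν(B(0,1))` cover `B̄(0,1)`. -/
theorem stmt12 (d : ℕ) (hd : 1 ≤ d) (lam : ℝ) (Φ : Euc d → ℝ) (U : Set (Euc d)) (μ : ℝ)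
    (T : Euc d → Matrix (Fin d) (Fin d) ℝ)
    (hlam : 1 ≤ lam)
    (hUo : IsOpen U) (hU : closedBall 0 1 ⊆ U)
    (hΦ : ContDiffOn ℝ (3 : ℕ) Φ U)
    (hμ : 0 < μ)
    (hgap : ∀ x ∈ closedBall (0 : Euc d) 1, ∀ y ∈ closedBall (0 : Euc d) 1,
      μ * ‖x - y‖ ≤ ‖gradient Φ x - gradient Φ y‖)
    (hT : ∀ ν ∈ closedBall (0 : Euc d) 1, IsAbsInvSqrtHess Φ ν (T ν)) :
    ∃ I : Finset (Euc d),
      (I : Set (Euc d)) ⊆ closedBall 0 1 ∧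
      closedBall (0 : Euc d) 1 ⊆ ⋃ ν ∈ I, packet lam (T ν) ν 1 ∧
      ∀ ν ∈ I, ∀ σ ∈ I, ν ≠ σ →
        ν ∉ packet lam (T σ) σ 1 ∨ σ ∉ packet lam (T ν) ν 1 := by
  obtain ⟨C, hC0, hC⟩ := exists_norm_inv_le_of_isAbsInvSqrtHess
    (isCompact_closedBall (0 : Euc d) 1) hUo hU (hΦ.of_le (by norm_cast)) hT
  have hlam0 : 0 < lam := by linarith
  have hs : 0 < √lam := Real.sqrt_pos.2 hlam0
  exact (isCompact_closedBall (0 : Euc d) 1).totallyBounded.exists_finset_cover_separated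
    (fun ν => packet lam (T ν) ν 1) (r := (√lam * C)⁻¹) (by positivity) fun ν hν =>
      ball_subset_packet hlam0 (hT ν hν).1.det_pos.ne'.isUnit (hC ν hν)
        (mul_inv_cancel₀ (by positivity)).le hC0

end
end

section
/- Let d ≥ 1 and let Φ be a real-valued C³ function on a neighborhood of B̄(0,1) ⊂ ℝ^d satisfying |∇Φ(x) − ∇Φ(y)| ≥ μ|x − y| for all x, y ∈ B̄(0,1) for some μ > 0. Then for all ν, σ ∈ B̄(0,1) and every unit vector η ∈ ℝ^d, |(T_ν − T_σ)η| ≤ d^{7/2} · 𝒫₃ · μ^{-3/2} · |ν − σ|, where T_ν := |HΦ(ν)|^{-1/2}. Equivalently, ‖T_ν − T_σ‖_{op} ≤ d^{7/2} 𝒫₃ μ^{-3/2} |ν − σ|, so ν ↦ T_ν is Lipschitz continuous. -/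
open MeasureTheory Metric Set

noncomputable section

open Filter Topology
open scoped RealInnerProductSpace

/-- Eigenvectors of the square of an operator are eigenvectors of its positive definite inverse
fourth root. -/
lemma LinearMap.IsSymmetric.apply_eq_smul_of_apply_four
    {E : Type*} [NormedAddCommGroup E] [InnerProductSpace ℝ E]
    {T : E →ₗ[ℝ] E} (hT : T.IsSymmetric) (hpos : ∀ x, x ≠ 0 → 0 < ⟪T x, x⟫)
    {u : E} {c : ℝ} (hc : 0 < c) (h4 : T (T (T (T u))) = c ^ 4 • u) : T u = c • u := by
  set w := T u - c • u with hw
  set p := T w + c • w with hp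
  have h1 : T (T p) + c ^ 2 • p = 0 := by
    have : T (T p) + c ^ 2 • p = T (T (T (T u))) - c ^ 4 • u := by
      simp only [hp, hw, map_add, map_sub, map_smul]
      module
    rw [this, h4, sub_self]
  have hp0 : p = 0 := by
    have h2 : ⟪T p, T p⟫ + c ^ 2 * ⟪p, p⟫ = 0 := by
      rw [← hT (T p) p, ← real_inner_smul_left, ← inner_add_left, h1, inner_zero_left]
    rw [real_inner_self_eq_norm_sq, real_inner_self_eq_norm_sq] at h2
    have h3 : c ^ 2 * ‖p‖ ^ 2 = 0 :=
      le_antisymm (by nlinarith [sq_nonneg ‖T p‖]) (by positivity)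
    have h5 : ‖p‖ ^ 2 = 0 := (mul_eq_zero.1 h3).resolve_left (by positivity)
    exact norm_eq_zero.1 (pow_eq_zero_iff two_ne_zero |>.1 h5)
  by_contra hne
  have hw0 : w ≠ 0 := fun h => hne (sub_eq_zero.1 h)
  have h6 : ⟪T w, w⟫ + c * ⟪w, w⟫ = 0 := by
    rw [← real_inner_smul_left, ← inner_add_left, ← hp, hp0, inner_zero_left]
  have h7 := hpos w hw0
  have h8 : 0 ≤ c * ⟪w, w⟫ := mul_nonneg hc.le real_inner_self_nonneg
  linarith

lemma abs_inv_sqrt_abs_sub_le {μ h k : ℝ} (hμ : 0 < μ) (hh : μ ≤ |h|) (hk : μ ≤ |k|) :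
    |(√|h|)⁻¹ - (√|k|)⁻¹| ≤ (√μ)⁻¹ ^ 3 * |h - k| := by
  have hm : 0 < √μ := Real.sqrt_pos.2 hμ
  have ha : √μ ≤ √|h| := Real.sqrt_le_sqrt hh
  have hb : √μ ≤ √|k| := Real.sqrt_le_sqrt hk
  have hha : √|h| ^ 2 = |h| := Real.sq_sqrt (abs_nonneg h)
  have hkb : √|k| ^ 2 = |k| := Real.sq_sqrt (abs_nonneg k)
  have hd : |√|h| ^ 2 - √|k| ^ 2| ≤ |h - k| := by
    rw [hha, hkb]; exact abs_abs_sub_abs_le_abs_sub h k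
  generalize √|h| = a at *
  generalize √|k| = b at *
  generalize √μ = m at *
  have ha0 : 0 < a := hm.trans_le ha
  have hb0 : 0 < b := hm.trans_le hb
  have e : a⁻¹ - b⁻¹ = -(a ^ 2 - b ^ 2) * (a * b * (a + b))⁻¹ := by
    field_simp
    ring
  have hden : m ^ 3 ≤ a * b * (a + b) := by
    calc m ^ 3 = m * m * m := by ring
      _ ≤ a * b * (a + b) := by gcongr; linarith
  rw [e, abs_mul, abs_neg, mul_comm, abs_of_pos (by positivity : 0 < (a * b * (a + b))⁻¹), inv_pow]
  gcongr

/-- A scalar Lipschitz bound between the eigenvalues of two pairs of simultaneously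
diagonalized operators gives a Hilbert–Schmidt type bound. -/
lemma norm_sub_apply_le_of_eigenbases
    {E ι : Type*} [NormedAddCommGroup E] [InnerProductSpace ℝ E] [Fintype ι]
    {T S H K : E →ₗ[ℝ] E} (hT : T.IsSymmetric) (hH : H.IsSymmetric)
    (u v : OrthonormalBasis ι ℝ E) {a b h k : ι → ℝ}
    (hTu : ∀ i, T (u i) = a i • u i) (hSv : ∀ i, S (v i) = b i • v i)
    (hHu : ∀ i, H (u i) = h i • u i) (hKv : ∀ i, K (v i) = k i • v i)
    {L C : ℝ} (hL : 0 ≤ L) (hC : 0 ≤ C) (hlip : ∀ i j, |a i - b j| ≤ L * |h i - k j|)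
    (hHK : ∀ x, ‖H x - K x‖ ≤ C * ‖x‖) (x : E) :
    ‖T x - S x‖ ≤ L * (√(Fintype.card ι) * C) * ‖x‖ := by
  have hj : ∀ j, ‖T (v j) - S (v j)‖ ≤ L * C := by
    intro j
    have h1 : ‖T (v j) - S (v j)‖ ^ 2 ≤ (L * ‖H (v j) - K (v j)‖) ^ 2 := by
      rw [mul_pow, ← u.sum_sq_norm_inner_right, ← u.sum_sq_norm_inner_right, Finset.mul_sum]
      refine Finset.sum_le_sum fun i _ => ?_
      have e1 : ⟪u i, T (v j) - S (v j)⟫ = (a i - b j) * ⟪u i, v j⟫ := by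
        rw [inner_sub_right, ← hT, hTu, hSv, real_inner_smul_left, real_inner_smul_right, sub_mul]
      have e2 : ⟪u i, H (v j) - K (v j)⟫ = (h i - k j) * ⟪u i, v j⟫ := by
        rw [inner_sub_right, ← hH, hHu, hKv, real_inner_smul_left, real_inner_smul_right, sub_mul]
      rw [e1, e2, norm_mul, norm_mul, ← mul_pow, ← mul_assoc, Real.norm_eq_abs, Real.norm_eq_abs]
      gcongr
      exact hlip i j
    have h2 := abs_le_of_sq_le_sq h1 (by positivity)
    rw [abs_norm] at h2
    refine h2.trans ?_
    gcongr
    simpa using hHK (v j)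
  have hx : T x - S x = ∑ j, ⟪v j, x⟫ • (T (v j) - S (v j)) := by
    conv_lhs => rw [← v.sum_repr' x]
    simp only [map_sum, map_smul, smul_sub, Finset.sum_sub_distrib]
  have hsum : ∑ j, ‖⟪v j, x⟫‖ ≤ √(Fintype.card ι) * ‖x‖ := by
    rw [← Real.sqrt_sq (norm_nonneg x), ← Real.sqrt_mul (Nat.cast_nonneg _),
      ← v.sum_sq_norm_inner_right x]
    refine Real.le_sqrt_of_sq_le ?_
    simpa using sq_sum_le_card_mul_sum_sq (s := Finset.univ) (f := fun j => ‖⟪v j, x⟫‖)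
  calc ‖T x - S x‖ ≤ ∑ j, ‖⟪v j, x⟫‖ * (L * C) := by
        rw [hx]
        refine (norm_sum_le _ _).trans (Finset.sum_le_sum fun j _ => ?_)
        rw [norm_smul]
        gcongr
        exact hj j
    _ = (∑ j, ‖⟪v j, x⟫‖) * (L * C) := by rw [Finset.sum_mul]
    _ ≤ (√(Fintype.card ι) * ‖x‖) * (L * C) := by gcongr
    _ = L * (√(Fintype.card ι) * C) * ‖x‖ := by ring

/-- The map `A ↦ |A|^{-1/2}` is Lipschitz on symmetric operators whose eigenvalues are bounded
below by `μ` in absolute value. -/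
lemma norm_absInvSqrt_sub_apply_le
    {E : Type*} [NormedAddCommGroup E] [InnerProductSpace ℝ E] [FiniteDimensional ℝ E]
    {T S H K : E →ₗ[ℝ] E} (hT : T.IsSymmetric) (hS : S.IsSymmetric)
    (hH : H.IsSymmetric) (hK : K.IsSymmetric)
    (hTpos : ∀ x, x ≠ 0 → 0 < ⟪T x, x⟫) (hSpos : ∀ x, x ≠ 0 → 0 < ⟪S x, x⟫)
    (hTH : ∀ x, T (T (T (T (H (H x))))) = x) (hSK : ∀ x, S (S (S (S (K (K x))))) = x)
    {μ C : ℝ} (hμ : 0 < μ) (hC : 0 ≤ C)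
    (hHμ : ∀ x, μ * ‖x‖ ≤ ‖H x‖) (hKμ : ∀ x, μ * ‖x‖ ≤ ‖K x‖)
    (hHK : ∀ x, ‖H x - K x‖ ≤ C * ‖x‖) (x : E) :
    ‖T x - S x‖ ≤ (√μ)⁻¹ ^ 3 * (√(Module.finrank ℝ E) * C) * ‖x‖ := by
  have lower : ∀ {A : E →ₗ[ℝ] E} (hA : A.IsSymmetric), (∀ x, μ * ‖x‖ ≤ ‖A x‖) →
      ∀ i, μ ≤ |hA.eigenvalues rfl i| := by
    intro A hA hAμ i
    have h1 := hAμ (hA.eigenvectorBasis rfl i)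
    rw [hA.apply_eigenvectorBasis] at h1
    simpa [norm_smul] using h1
  have root : ∀ {A R : E →ₗ[ℝ] E} (hA : A.IsSymmetric), R.IsSymmetric →
      (∀ x, x ≠ 0 → 0 < ⟪R x, x⟫) → (∀ x, R (R (R (R (A (A x))))) = x) →
      (∀ x, μ * ‖x‖ ≤ ‖A x‖) → ∀ i, R (hA.eigenvectorBasis rfl i) =
        (√|hA.eigenvalues rfl i|)⁻¹ • hA.eigenvectorBasis rfl i := by
    intro A R hA hR hpos hRA hAμ i
    have hl : 0 < |hA.eigenvalues rfl i| := hμ.trans_le (lower hA hAμ i)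
    refine hR.apply_eq_smul_of_apply_four hpos (by positivity) ?_
    have h1 := hRA (hA.eigenvectorBasis rfl i)
    simp only [hA.apply_eigenvectorBasis, map_smul, smul_smul] at h1
    have h2 : (√|hA.eigenvalues rfl i|)⁻¹ ^ 4 =
        (hA.eigenvalues rfl i * hA.eigenvalues rfl i)⁻¹ := by
      rw [inv_pow, show 4 = 2 * 2 from rfl, pow_mul, Real.sq_sqrt hl.le, sq_abs, sq]
    have h3 : hA.eigenvalues rfl i * hA.eigenvalues rfl i ≠ 0 :=
      mul_self_ne_zero.2 (abs_pos.1 hl)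
    rw [h2, eq_inv_smul_iff₀ h3]
    exact h1
  have := norm_sub_apply_le_of_eigenbases hT hH (hH.eigenvectorBasis rfl)
    (hK.eigenvectorBasis rfl) (root hH hT hTpos hTH hHμ) (root hK hS hSpos hSK hKμ)
    (hH.apply_eigenvectorBasis rfl) (hK.apply_eigenvectorBasis rfl)
    (L := (√μ)⁻¹ ^ 3) (by positivity) hC
    (fun i j => abs_inv_sqrt_abs_sub_le hμ (lower hH hHμ i) (lower hK hKμ j)) hHK x
  simpa using this

lemma HasFDerivAt.mul_norm_le_norm_apply
    {E F : Type*} [NormedAddCommGroup E] [NormedSpace ℝ E] [NormedAddCommGroup F]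
    [NormedSpace ℝ F] {f : E → F} {f' : E →L[ℝ] F} {x : E} {μ : ℝ} (hf : HasFDerivAt f f' x)
    (h : ∀ᶠ y in 𝓝 x, μ * ‖y - x‖ ≤ ‖f y - f x‖) (v : E) : μ * ‖v‖ ≤ ‖f' v‖ := by
  refine ge_of_tendsto (hf.lim_real v).norm ?_
  have ht : Tendsto (fun c : ℝ => x + c⁻¹ • v) atTop (𝓝 x) := by
    simpa using ((tendsto_inv_atTop_zero (𝕜 := ℝ)).smul_const v).const_add x
  filter_upwards [ht.eventually h, eventually_gt_atTop (0 : ℝ)] with c hc hc0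
  rw [add_sub_cancel_left, norm_smul, norm_inv, Real.norm_of_nonneg hc0.le] at hc
  rw [norm_smul, Real.norm_of_nonneg hc0.le]
  calc μ * ‖v‖ = c * (μ * (c⁻¹ * ‖v‖)) := by field_simp
    _ ≤ _ := by gcongr

set_option maxSynthPendingDepth 3 in
lemma norm_fderiv_fderiv_fderiv
    {E F : Type*} [NormedAddCommGroup E] [NormedSpace ℝ E] [NormedAddCommGroup F]
    [NormedSpace ℝ F] (f : E → F) (x : E) :
    ‖fderiv ℝ (fderiv ℝ (fderiv ℝ f)) x‖ = ‖iteratedFDeriv ℝ 3 f x‖ := by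
  rw [← norm_iteratedFDeriv_one, norm_iteratedFDeriv_fderiv, norm_iteratedFDeriv_fderiv]

section Hessian

variable {d : ℕ} {Φ : Euc d → ℝ} {x : Euc d}

lemma mulVecE_eq_toEuclideanLin (M : Matrix (Fin d) (Fin d) ℝ) (x : Euc d) :
    mulVecE M x = M.toEuclideanLin x := rfl

lemma inner_toEuclideanLin_hess (hs : IsSymmSndFDerivAt ℝ Φ x) (v w : Euc d) :
    ⟪(Hess Φ x).toEuclideanLin v, w⟫ = fderiv ℝ (fderiv ℝ Φ) x v w := by
  have key : ∀ i j, ⟪(Hess Φ x).toEuclideanLin (EuclideanSpace.single i 1),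
      EuclideanSpace.single j 1⟫ = fderiv ℝ (fderiv ℝ Φ) x (EuclideanSpace.single i 1)
        (EuclideanSpace.single j 1) := by
    intro i j
    rw [hs.eq]
    simp [Hess, iteratedFDeriv_two_apply, EuclideanSpace.inner_single_right]
  have hv : v = ∑ i, v i • EuclideanSpace.single i (1 : ℝ) := by
    simpa using ((EuclideanSpace.basisFun (Fin d) ℝ).sum_repr v).symm
  have hw : w = ∑ i, w i • EuclideanSpace.single i (1 : ℝ) := by
    simpa using ((EuclideanSpace.basisFun (Fin d) ℝ).sum_repr w).symm
  rw [hv, hw]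
  simp only [map_sum, map_smul, sum_inner, inner_sum, real_inner_smul_left,
    real_inner_smul_right, key, sum_apply, smul_apply,
    smul_eq_mul, Finset.mul_sum]

lemma isSymmetric_toEuclideanLin_hess (hs : IsSymmSndFDerivAt ℝ Φ x) :
    (Hess Φ x).toEuclideanLin.IsSymmetric := by
  intro v w
  rw [inner_toEuclideanLin_hess hs, real_inner_comm, inner_toEuclideanLin_hess hs, hs.eq]

lemma toDual_toEuclideanLin_hess (hs : IsSymmSndFDerivAt ℝ Φ x) (v : Euc d) :
    InnerProductSpace.toDual ℝ (Euc d) ((Hess Φ x).toEuclideanLin v) =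
      fderiv ℝ (fderiv ℝ Φ) x v := by
  ext w
  exact inner_toEuclideanLin_hess hs v w

lemma norm_toEuclideanLin_hess (hs : IsSymmSndFDerivAt ℝ Φ x) (v : Euc d) :
    ‖(Hess Φ x).toEuclideanLin v‖ = ‖fderiv ℝ (fderiv ℝ Φ) x v‖ := by
  rw [← toDual_toEuclideanLin_hess hs, LinearIsometryEquiv.norm_map]

lemma norm_toEuclideanLin_hess_sub {y : Euc d} (hx : IsSymmSndFDerivAt ℝ Φ x)
    (hy : IsSymmSndFDerivAt ℝ Φ y) (v : Euc d) :
    ‖(Hess Φ x).toEuclideanLin v - (Hess Φ y).toEuclideanLin v‖ =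
      ‖(fderiv ℝ (fderiv ℝ Φ) x - fderiv ℝ (fderiv ℝ Φ) y) v‖ := by
  rw [sub_apply, ← toDual_toEuclideanLin_hess hx,
    ← toDual_toEuclideanLin_hess hy, ← map_sub, LinearIsometryEquiv.norm_map]

lemma norm_gradient_sub (x y : Euc d) :
    ‖gradient Φ x - gradient Φ y‖ = ‖fderiv ℝ Φ x - fderiv ℝ Φ y‖ := by
  rw [gradient, gradient, ← map_sub, LinearIsometryEquiv.norm_map]

lemma IsAbsInvSqrtHess.apply_four {T : Matrix (Fin d) (Fin d) ℝ}
    (h : IsAbsInvSqrtHess Φ x T) (v : Euc d) :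
    T.toEuclideanLin (T.toEuclideanLin (T.toEuclideanLin (T.toEuclideanLin
      ((Hess Φ x).toEuclideanLin ((Hess Φ x).toEuclideanLin v))))) = v := by
  have h1 : (T * T * T * T) * (Hess Φ x * Hess Φ x) = 1 := mul_eq_one_comm.1 h.2
  simp only [Matrix.toLpLin_apply, Matrix.mulVec_mulVec]
  rw [show T * (T * (T * (T * (Hess Φ x * Hess Φ x)))) = 1 by simpa [Matrix.mul_assoc] using h1]
  simp

lemma IsAbsInvSqrtHess.isSymmetric {T : Matrix (Fin d) (Fin d) ℝ}
    (h : IsAbsInvSqrtHess Φ x T) : T.toEuclideanLin.IsSymmetric :=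
  Matrix.isSymmetric_toEuclideanLin_iff.2 h.1.isHermitian

lemma IsAbsInvSqrtHess.inner_pos {T : Matrix (Fin d) (Fin d) ℝ}
    (h : IsAbsInvSqrtHess Φ x T) (v : Euc d) (hv : v ≠ 0) : 0 < ⟪T.toEuclideanLin v, v⟫ := by
  have := h.1.dotProduct_mulVec_pos (x := v.ofLp) (by simpa using hv)
  simpa [EuclideanSpace.inner_eq_star_dotProduct, Matrix.toLpLin_apply] using this

end Hessian

/-- Lemma `hessianhalf`: Lipschitz continuity of
`ν ↦ T_ν = |HΦ(ν)|^{-1/2}`: for all `ν, σ ∈ B̄(0,1)` and unit vectors `η`,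
`|(T_ν − T_σ)η| ≤ d^{7/2} 𝒫₃ μ^{-3/2} |ν − σ|`. -/
theorem stmt15 (d : ℕ) (hd : 1 ≤ d) (Φ : Euc d → ℝ) (U : Set (Euc d)) (μ : ℝ)
    (hUo : IsOpen U) (hU : closedBall 0 1 ⊆ U)
    (hΦ : ContDiffOn ℝ (3 : ℕ) Φ U)
    (hμ : 0 < μ)
    (hgap : ∀ x ∈ closedBall (0 : Euc d) 1, ∀ y ∈ closedBall (0 : Euc d) 1,
      μ * ‖x - y‖ ≤ ‖gradient Φ x - gradient Φ y‖) :
    ∀ ν ∈ closedBall (0 : Euc d) 1, ∀ σ ∈ closedBall (0 : Euc d) 1,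
      ∀ Tν Tσ : Matrix (Fin d) (Fin d) ℝ,
        IsAbsInvSqrtHess Φ ν Tν → IsAbsInvSqrtHess Φ σ Tσ →
        ∀ η : Euc d, ‖η‖ = 1 →
          ‖mulVecE (Tν - Tσ) η‖ ≤
            (d : ℝ) ^ ((7 : ℝ) / 2) * Pnorm 3 Φ (ball 0 1) * μ ^ (-(3 : ℝ) / 2) *
              ‖ν - σ‖ := by
  have hne : (1 : ℝ) ≠ 0 := one_ne_zero
  have hat : ∀ x ∈ closedBall (0 : Euc d) 1, ContDiffAt ℝ (3 : ℕ) Φ x := fun x hx =>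
    hΦ.contDiffAt (hUo.mem_nhds (hU hx))
  have hd1 : ∀ x ∈ closedBall (0 : Euc d) 1, ContDiffAt ℝ 2 (fderiv ℝ Φ) x := fun x hx =>
    (hat x hx).fderiv_right (by norm_num)
  have hd2 : ∀ x ∈ closedBall (0 : Euc d) 1, ContDiffAt ℝ 1 (fderiv ℝ (fderiv ℝ Φ)) x :=
    fun x hx => (hd1 x hx).fderiv_right (by norm_num)
  have hsymm : ∀ x ∈ closedBall (0 : Euc d) 1, IsSymmSndFDerivAt ℝ Φ x := fun x hx =>
    (hat x hx).isSymmSndFDerivAt (by simp; norm_num)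
  have hcont2 : ContinuousOn (fderiv ℝ (fderiv ℝ Φ)) (closedBall 0 1) := fun x hx =>
    (hd2 x hx).continuousAt.continuousWithinAt
  have hcont3 : ContinuousOn (fun x => ‖iteratedFDeriv ℝ 3 Φ x‖) (closedBall 0 1) := by
    intro x hx
    simp only [← norm_fderiv_fderiv_fderiv]
    exact ((hd2 x hx).fderiv_right (m := 0) (by norm_num)).continuousAt.norm.continuousWithinAt
  have hclos : closure (ball (0 : Euc d) 1) = closedBall 0 1 := closure_ball 0 hne
  have hlow : ∀ x ∈ closedBall (0 : Euc d) 1, ∀ v,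
      μ * ‖v‖ ≤ ‖(Hess Φ x).toEuclideanLin v‖ := by
    intro x hx v
    rw [norm_toEuclideanLin_hess (hsymm x hx)]
    refine le_on_closure (s := ball (0 : Euc d) 1) (f := fun _ => μ * ‖v‖)
      (g := fun x => ‖fderiv ℝ (fderiv ℝ Φ) x v‖) (fun y hy => ?_) continuousOn_const ?_
      (hclos ▸ hx)
    · have hy' := ball_subset_closedBall hy
      refine HasFDerivAt.mul_norm_le_norm_apply
        ((hd1 y hy').differentiableAt (by norm_num)).hasFDerivAt ?_ v
      filter_upwards [isOpen_ball.mem_nhds hy] with z hz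
      rw [← norm_gradient_sub]
      exact hgap z (ball_subset_closedBall hz) y hy'
    · rw [hclos]
      exact (hcont2.clm_apply continuousOn_const).norm
  have hbdd : BddAbove ((fun x => ‖iteratedFDeriv ℝ 3 Φ x‖) '' ball (0 : Euc d) 1) :=
    ((isCompact_closedBall 0 1).bddAbove_image hcont3).mono (image_mono ball_subset_closedBall)
  have hnonneg : ∀ j, 0 ≤ supDeriv j Φ (ball 0 1) := fun j =>
    Real.sSup_nonneg (by rintro _ ⟨x, -, rfl⟩; exact norm_nonneg _)
  set M := supDeriv 3 Φ (ball 0 1)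
  have hMP : M ≤ Pnorm 3 Φ (ball 0 1) :=
    Finset.single_le_sum (f := fun j => supDeriv j Φ (ball 0 1)) (fun j _ => hnonneg j)
      (by simp : 3 ∈ Finset.Icc 2 3)
  have hM0 : 0 ≤ M := hnonneg 3
  have hlipball : LipschitzOnWith M.toNNReal (fderiv ℝ (fderiv ℝ Φ)) (ball 0 1) := by
    refine (convex_ball 0 1).lipschitzOnWith_of_nnnorm_fderiv_le
      (fun y hy => (hd2 y (ball_subset_closedBall hy)).differentiableAt (by norm_num))
      fun y hy => ?_
    rw [← NNReal.coe_le_coe, coe_nnnorm, Real.coe_toNNReal _ hM0, norm_fderiv_fderiv_fderiv]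
    exact le_csSup hbdd (mem_image_of_mem _ hy)
  have hlip : LipschitzOnWith M.toNNReal (fderiv ℝ (fderiv ℝ Φ)) (closedBall 0 1) := by
    rw [← hclos] at hcont2 ⊢
    exact hlipball.closure hcont2
  intro ν hν σ hσ Tν Tσ hTν hTσ η hη
  have hHK : ∀ v, ‖(Hess Φ ν).toEuclideanLin v - (Hess Φ σ).toEuclideanLin v‖ ≤
      (M * ‖ν - σ‖) * ‖v‖ := by
    intro v
    rw [norm_toEuclideanLin_hess_sub (hsymm ν hν) (hsymm σ hσ)]
    refine (ContinuousLinearMap.le_opNorm _ v).trans ?_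
    gcongr
    simpa [hM0] using hlip.norm_sub_le hν hσ
  have main := norm_absInvSqrt_sub_apply_le hTν.isSymmetric hTσ.isSymmetric
    (isSymmetric_toEuclideanLin_hess (hsymm ν hν)) (isSymmetric_toEuclideanLin_hess (hsymm σ hσ))
    hTν.inner_pos hTσ.inner_pos hTν.apply_four hTσ.apply_four hμ (by positivity)
    (hlow ν hν) (hlow σ hσ) hHK η
  rw [hη, mul_one, finrank_euclideanSpace_fin] at main
  rw [mulVecE_eq_toEuclideanLin, map_sub, LinearMap.sub_apply]
  have hμpow : (√μ)⁻¹ ^ 3 = μ ^ (-(3 : ℝ) / 2) := by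
    rw [Real.sqrt_eq_rpow, ← Real.rpow_neg hμ.le, ← Real.rpow_natCast, ← Real.rpow_mul hμ.le]
    norm_num
  have hdpow : √(d : ℝ) ≤ (d : ℝ) ^ ((7 : ℝ) / 2) := by
    rw [Real.sqrt_eq_rpow]
    exact Real.rpow_le_rpow_of_exponent_le (by exact_mod_cast hd) (by norm_num)
  rw [hμpow] at main
  calc _ ≤ _ := main
    _ = √(d : ℝ) * M * μ ^ (-(3 : ℝ) / 2) * ‖ν - σ‖ := by ring
    _ ≤ _ := by gcongr

end
end

section
/- Let A and B be d×d real symmetric matrices. Then ‖|A| − |B|‖_F ≤ ‖A − B‖_F, where |A| denotes the matrix absolute value of A and ‖·‖_F is the Frobenius norm. -/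
noncomputable section

/-- The Frobenius norm of a square matrix. -/
noncomputable def frobNorm {d : ℕ} (M : Matrix (Fin d) (Fin d) ℝ) : ℝ :=
  Real.sqrt (∑ i, ∑ j, M i j ^ 2)

/-- The matrix absolute value: `P = |A|` iff `P` is positive semidefinite and `P² = A²`
(for symmetric `A` this characterizes `|A| = ᵗQ·diag(|μ₁|,…,|μ_d|)·Q`). -/
def IsMatrixAbs {d : ℕ} (A P : Matrix (Fin d) (Fin d) ℝ) : Prop :=
  P.PosSemidef ∧ P * P = A * A

open scoped Matrix

/-- A product of two positive semidefinite real matrices has nonnegative trace. -/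
lemma Matrix.PosSemidef.trace_mul_nonneg {n : Type*} [Fintype n]
    {M N : Matrix n n ℝ} (hM : M.PosSemidef) (hN : N.PosSemidef) : 0 ≤ (M * N).trace := by
  classical
  obtain ⟨C, rfl⟩ : ∃ C : Matrix n n ℝ, N = Cᴴ * C := by
    open scoped MatrixOrder in
    exact CStarAlgebra.nonneg_iff_eq_star_mul_self.mp hN.nonneg
  rw [← Matrix.mul_assoc, Matrix.trace_mul_comm, ← Matrix.mul_assoc]
  exact (hM.mul_mul_conjTranspose_same C).trace_nonneg

/-- If `P` is positive semidefinite, `A` is symmetric and `P² = A²`, then `A ≤ P` in the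
Loewner order. -/
lemma Matrix.PosSemidef.sub_of_mul_self_eq {n : Type*} [Fintype n]
    {A P : Matrix n n ℝ} (hP : P.PosSemidef) (hA : A.IsSymm) (h : P * P = A * A) :
    (P - A).PosSemidef := by
  classical
  have hPs : Pᵀ = P := by simpa using hP.isHermitian.eq
  have hH : (P - A).IsHermitian := by simp [Matrix.IsHermitian, hPs, hA.eq]
  rw [hH.posSemidef_iff_eigenvalues_nonneg]
  intro i
  by_contra! hneg
  set c : ℝ := hH.eigenvalues i
  set v : n → ℝ := ⇑(hH.eigenvectorBasis i)
  have hPv : P *ᵥ v = A *ᵥ v + c • v := by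
    have := hH.mulVec_eigenvectorBasis i
    rw [Matrix.sub_mulVec, sub_eq_iff_eq_add'] at this
    exact this
  have hv0 : 0 < v ⬝ᵥ v := by
    refine lt_of_le_of_ne (Finset.sum_nonneg fun j _ => mul_self_nonneg _) fun h0 => ?_
    apply hH.eigenvectorBasis.orthonormal.ne_zero i
    ext j
    exact congrFun (dotProduct_self_eq_zero.mp h0.symm) j
  have key : ∀ M : Matrix n n ℝ, Mᵀ = M → v ⬝ᵥ ((M * M) *ᵥ v) = (M *ᵥ v) ⬝ᵥ (M *ᵥ v) := by
    intro M hM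
    rw [← Matrix.mulVec_mulVec, Matrix.dotProduct_mulVec, ← Matrix.mulVec_transpose, hM]
  have hsq := key P hPs
  rw [h, key A hA.eq, hPv] at hsq
  have hpos : 0 ≤ v ⬝ᵥ (P *ᵥ v) := by simpa using hP.dotProduct_mulVec_nonneg v
  rw [hPv] at hpos
  simp only [dotProduct_add, add_dotProduct, dotProduct_smul, smul_dotProduct, smul_eq_mul,
    dotProduct_comm (A *ᵥ v) v] at hsq hpos
  have h2 : c * (2 * (v ⬝ᵥ (A *ᵥ v)) + c * (v ⬝ᵥ v)) = 0 := by linarith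
  have h3 := (mul_eq_zero.mp h2).resolve_left hneg.ne
  nlinarith [mul_neg_of_neg_of_pos hneg hv0]

lemma sum_sq_eq_trace_mul_self {n : Type*} [Fintype n] {M : Matrix n n ℝ} (hM : M.IsSymm) :
    ∑ i, ∑ j, M i j ^ 2 = (M * M).trace := by
  simp only [Matrix.trace, Matrix.diag, Matrix.mul_apply]
  exact Finset.sum_congr rfl fun i _ => Finset.sum_congr rfl fun j _ => by
    rw [hM.apply i j, sq]

/-- for symmetric matrices `A`, `B` one has `‖|A| − |B|‖_F ≤ ‖A − B‖_F`. -/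
theorem stmt18 (d : ℕ) (A B P Q : Matrix (Fin d) (Fin d) ℝ)
    (hA : A.IsSymm) (hB : B.IsSymm)
    (hP : IsMatrixAbs A P) (hQ : IsMatrixAbs B Q) :
    frobNorm (P - Q) ≤ frobNorm (A - B) := by
  obtain ⟨hP, hPA⟩ := hP
  obtain ⟨hQ, hQB⟩ := hQ
  have hPs : P.IsSymm := by simpa [Matrix.IsSymm] using hP.isHermitian.eq
  have hQs : Q.IsSymm := by simpa [Matrix.IsSymm] using hQ.isHermitian.eq
  have hPsubA := hP.sub_of_mul_self_eq hA hPA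
  have hPaddA := hP.sub_of_mul_self_eq hA.neg (by simpa using hPA)
  have hQsubB := hQ.sub_of_mul_self_eq hB hQB
  have hQaddB := hQ.sub_of_mul_self_eq hB.neg (by simpa using hQB)
  have h₁ := hPaddA.trace_mul_nonneg hQsubB
  have h₂ := hPsubA.trace_mul_nonneg hQaddB
  unfold frobNorm
  apply Real.sqrt_le_sqrt
  rw [sum_sq_eq_trace_mul_self (hPs.sub hQs), sum_sq_eq_trace_mul_self (hA.sub hB)]
  simp only [sub_mul, mul_sub, neg_mul, mul_neg, Matrix.trace_sub, Matrix.trace_neg, hPA, hQB,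
    Matrix.trace_mul_comm Q P, Matrix.trace_mul_comm B A] at h₁ h₂ ⊢
  linarith

end
end
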